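/- arXiv:0903.3839 — 2 statements merged into one kernel-verified Lean document; each statement's English description precedes it below -/
import Mathlib

section
/- Let D be a central essential hyperplane arrangement in ℂ^n (multiplicities allowed) which is not a normal crossing divisor, with defining polynomial f = ∏_i g_i^{m_i}. For α ∈ (0,1): α ∈ JC(D) if and only if there exist an edge V ∈ S(D) with μ(V) > γ(V) and an injective linear map ψ : ℂ^{γ(V)} → ℂ^n whose image is a linear complement of V in ℂ^n, such that α is a jumping coefficient at 0 ∈ ℂ^{γ(V)} of the central arrangement in ℂ^{γ(V)} with defining polynomial ∏_{i∈I(V)} (g_i ∘ ψ)^{m_i}. (Jumping-coefficient form of Proposition 1: jumping coefficients in (0,1) localize to the edges V contained in the non-reduced-normal-crossing locus D^{nrnc}, an edge V being contained in D^{nrnc} exactly when μ(V) > γ(V).) -/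
open MeasureTheory
open scoped Classical

noncomputable section

/-- A central hyperplane arrangement (with multiplicities) in `ℂ^n`, given by a finite
nonempty family of pairwise non-proportional nonzero linear forms `g i` with
multiplicities `m i ≥ 1`. -/
structure Arrangement (n : ℕ) where
  ι : Type
  fintypeι : Fintype ι
  nonemptyι : Nonempty ι
  g : ι → ((Fin n → ℂ) →ₗ[ℂ] ℂ)
  m : ι → ℕ
  g_ne : ∀ i, g i ≠ 0
  m_pos : ∀ i, 0 < m i
  nonproportional : ∀ i j : ι, i ≠ j → ∀ c : ℂ, g i ≠ c • g j

attribute [instance] Arrangement.fintypeι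

namespace Arrangement

variable {n : ℕ}

/-- The defining polynomial `f = ∏ i, g i ^ m i` of the arrangement, as a function. -/
def f (D : Arrangement n) (x : Fin n → ℂ) : ℂ :=
  ∏ i, D.g i x ^ D.m i

/-- The degree `d = ∑ i, m i` of the arrangement. -/
def degree (D : Arrangement n) : ℕ := ∑ i, D.m i

/-- The arrangement is essential: the intersection of its hyperplanes is `{0}`. -/
def Essential (D : Arrangement n) : Prop :=
  (⨅ i, LinearMap.ker (D.g i)) = ⊥

/-- The arrangement is reduced: all multiplicities are `1`. -/
def Reduced (D : Arrangement n) : Prop := ∀ i, D.m i = 1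

/-- The set of edges `S(D)`: intersections of nonempty subfamilies of the hyperplanes. -/
def edges (D : Arrangement n) : Set (Submodule ℂ (Fin n → ℂ)) :=
  {V | ∃ I : Set D.ι, I.Nonempty ∧ V = ⨅ i ∈ I, LinearMap.ker (D.g i)}

/-- The codimension `γ(V)` of an edge. -/
def gamma (_D : Arrangement n) (V : Submodule ℂ (Fin n → ℂ)) : ℕ :=
  n - Module.finrank ℂ V

/-- The multiplicity `μ(V) = ∑_{i : V ⊆ D_i} m i` of an edge. -/
def mu (D : Arrangement n) (V : Submodule ℂ (Fin n → ℂ)) : ℕ :=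
  ∑ i ∈ Finset.univ.filter fun i => V ≤ LinearMap.ker (D.g i), D.m i

/-- The reduced multiplicity `μ_red(V) = #{i : V ⊆ D_i}` of an edge. -/
def muRed (D : Arrangement n) (V : Submodule ℂ (Fin n → ℂ)) : ℕ :=
  (Finset.univ.filter fun i => V ≤ LinearMap.ker (D.g i)).card

end Arrangement

/-- `α` is a jumping coefficient of (the divisor of) `f` at the point `x`: there is a
function `g` holomorphic near `x` with `|g|²·|f|^(−2β)` locally integrable at `x` for all
`0 < β < α`, while `|g|²·|f|^(−2α)` is not integrable on any neighborhood of `x`. -/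
def JumpingAtOf {k : ℕ} (f : (Fin k → ℂ) → ℂ) (α : ℝ) (x : Fin k → ℂ) : Prop :=
  ∃ (U : Set (Fin k → ℂ)) (g : (Fin k → ℂ) → ℂ), U ∈ nhds x ∧ DifferentiableOn ℂ g U ∧
    (∀ β : ℝ, 0 < β → β < α →
      ∃ W ∈ nhds x, IntegrableOn (fun y => ‖g y‖ ^ 2 * ‖f y‖ ^ (-2 * β)) W) ∧
    ∀ W ∈ nhds x, ¬ IntegrableOn (fun y => ‖g y‖ ^ 2 * ‖f y‖ ^ (-2 * α)) W

/-- The set `JC(D)` of jumping coefficients of the arrangement `D`. -/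
def Arrangement.JC {n : ℕ} (D : Arrangement n) : Set ℝ :=
  {α | 0 < α ∧ ∃ x : Fin n → ℂ, JumpingAtOf D.f α x}

open Filter Topology Set
open scoped ENNReal

/-- The density `|g|² |f|^(-2β)` with values in `[0, ∞]`. -/
def dens {A : Type*} (f g : A → ℂ) (β : ℝ) (y : A) : ℝ≥0∞ :=
  ‖g y‖ₑ ^ 2 * ENNReal.ofReal (‖f y‖ ^ (-2 * β))

lemma dens_measurable {A : Type*} [MeasurableSpace A] {f g : A → ℂ}
    (hf : Measurable f) (hg : Measurable g) (β : ℝ) : Measurable (dens f g β) := by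
  unfold dens
  fun_prop

lemma dens_eq_ofReal {A : Type*} (f g : A → ℂ) (β : ℝ) (y : A) :
    dens f g β y = ENNReal.ofReal (‖g y‖ ^ 2 * ‖f y‖ ^ (-2 * β)) := by
  rw [dens, ENNReal.ofReal_mul (by positivity), ENNReal.ofReal_pow (norm_nonneg _),
    ofReal_norm]

lemma dens_le_of_le {A : Type*} {f g : A → ℂ} {β α M : ℝ} (hβ : 0 < β) (hβα : β ≤ α) {y : A}
    (hM : ‖f y‖ ≤ M) :
    dens f g β y ≤ ENNReal.ofReal (M ^ (2 * (α - β))) * dens f g α y := by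
  rw [dens, dens, mul_left_comm]
  gcongr
  rw [← ENNReal.ofReal_mul (Real.rpow_nonneg ((norm_nonneg _).trans hM) _)]
  refine ENNReal.ofReal_le_ofReal ?_
  rcases eq_or_ne (f y) 0 with h | h
  · rw [h, norm_zero, Real.zero_rpow (by linarith)]
    exact mul_nonneg (Real.rpow_nonneg ((norm_nonneg _).trans hM) _) (Real.rpow_nonneg le_rfl _)
  · have h' : 0 < ‖f y‖ := norm_pos_iff.2 h
    calc ‖f y‖ ^ (-2 * β) = ‖f y‖ ^ (2 * (α - β)) * ‖f y‖ ^ (-2 * α) := by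
          rw [← Real.rpow_add h']; ring_nf
      _ ≤ _ := by
          gcongr

section LocalFiniteness

variable {A B : Type*} [TopologicalSpace A] [MeasurableSpace A]
  [TopologicalSpace B] [MeasurableSpace B]

/-- The density `Φ` has finite integral on some neighborhood of `p`. -/
def LocFin (μ : Measure A) (Φ : A → ℝ≥0∞) (p : A) : Prop :=
  ∃ W ∈ 𝓝 p, ∫⁻ y in W, Φ y ∂μ < ⊤

lemma LocFin.mono_of_le {μ : Measure A} [OpensMeasurableSpace A] {Φ Ψ : A → ℝ≥0∞} {p : A}
    (h : LocFin μ Ψ p) {C : ℝ≥0∞} (hC : C ≠ ⊤) (hle : ∀ᶠ y in 𝓝 p, Φ y ≤ C * Ψ y) :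
    LocFin μ Φ p := by
  obtain ⟨W, hW, hfin⟩ := h
  obtain ⟨O, hO, hOo, hpO⟩ := eventually_nhds_iff.1 (hle.and hW)
  refine ⟨O, hOo.mem_nhds hpO, ?_⟩
  calc ∫⁻ y in O, Φ y ∂μ ≤ ∫⁻ y in O, C * Ψ y ∂μ :=
        setLIntegral_mono' hOo.measurableSet fun y hy => (hO y hy).1
    _ = C * ∫⁻ y in O, Ψ y ∂μ := lintegral_const_mul' _ _ hC
    _ ≤ C * ∫⁻ y in W, Ψ y ∂μ := by
        gcongr
        exact fun y hy => (hO y hy).2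
    _ < ⊤ := ENNReal.mul_lt_top hC.lt_top hfin

lemma LocFin.eventually {μ : Measure A} {Φ : A → ℝ≥0∞} {p : A} (h : LocFin μ Φ p) :
    ∀ᶠ q in 𝓝 p, LocFin μ Φ q := by
  obtain ⟨W, hW, hfin⟩ := h
  filter_upwards [eventually_mem_nhds_iff.2 hW] with q hq using ⟨W, hq, hfin⟩

lemma IsCompact.setLIntegral_lt_top_of_locFin {μ : Measure A} {Φ : A → ℝ≥0∞} {K : Set A}
    (hK : IsCompact K) (h : ∀ p ∈ K, LocFin μ Φ p) : ∫⁻ y in K, Φ y ∂μ < ⊤ := by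
  refine hK.induction_on (p := fun s => ∫⁻ y in s, Φ y ∂μ < ⊤) (by simp)
    (fun s t hst ht => (lintegral_mono_set hst).trans_lt ht)
    (fun s t hs ht => (lintegral_union_le _ _ _).trans_lt (ENNReal.add_lt_top.2 ⟨hs, ht⟩)) ?_
  intro p hp
  obtain ⟨W, hW, hfin⟩ := h p hp
  exact ⟨W, mem_nhdsWithin_of_mem_nhds hW, hfin⟩

lemma locFin_of_continuousAt {μ : Measure A} [IsLocallyFiniteMeasure μ] [OpensMeasurableSpace A]
    {Φ : A → ℝ≥0∞} {p : A} (h : ContinuousAt Φ p) (hp : Φ p ≠ ⊤) : LocFin μ Φ p := by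
  refine LocFin.mono_of_le (Ψ := 1) (C := Φ p + 1) ?_ (by simp [hp]) ?_
  · obtain ⟨s, hs, hfin⟩ := μ.finiteAt_nhds p
    exact ⟨s, hs, by simpa using hfin⟩
  · filter_upwards [h.eventually_lt continuousAt_const
      (ENNReal.lt_add_right hp one_ne_zero)] with y hy
    simpa using hy.le

/-- Transport of local finiteness along a homeomorphism scaling the measures. -/
lemma locFin_homeomorph_iff [BorelSpace A] [BorelSpace B] {μ : Measure A} {ν : Measure B}
    (e : A ≃ₜ B) {c : ℝ≥0∞} (hc0 : c ≠ 0) (hct : c ≠ ⊤) (he : μ.map e = c • ν)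
    (Φ : B → ℝ≥0∞) (p : A) : LocFin ν Φ (e p) ↔ LocFin μ (fun a => Φ (e a)) p := by
  have key : ∀ W : Set B, ∫⁻ a in e ⁻¹' W, Φ (e a) ∂μ = c * ∫⁻ b in W, Φ b ∂ν := by
    intro W
    rw [← smul_eq_mul, ← lintegral_smul_measure, ← Measure.restrict_smul, ← he,
      e.measurableEmbedding.restrict_map, e.measurableEmbedding.lintegral_map]
  constructor
  · rintro ⟨W, hW, hfin⟩
    exact ⟨e ⁻¹' W, e.continuous.continuousAt hW, by
      rw [key]; exact ENNReal.mul_lt_top hct.lt_top hfin⟩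
  · rintro ⟨W, hW, hfin⟩
    refine ⟨e '' W, e.isOpenMap.image_mem_nhds hW, ?_⟩
    have := key (e '' W)
    rw [e.injective.preimage_image] at this
    rw [this] at hfin
    exact lt_top_iff_ne_top.2 fun h => by simp [h, hc0] at hfin

/-- Multiplying `f` by a nonvanishing continuous factor does not affect local finiteness. -/
lemma locFin_dens_mul_unit_iff [OpensMeasurableSpace A] {μ : Measure A} {F c : A → ℂ} {p : A}
    (hc : ContinuousAt c p) (hcp : c p ≠ 0) (g : A → ℂ) (β : ℝ) :
    LocFin μ (dens (fun y => F y * c y) g β) p ↔ LocFin μ (dens F g β) p := by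
  have main : ∀ (F c : A → ℂ), ContinuousAt c p → c p ≠ 0 →
      LocFin μ (dens F g β) p → LocFin μ (dens (fun y => F y * c y) g β) p := by
    intro F c hc hcp h
    have hcont : ContinuousAt (fun y => ‖c y‖ ^ (-2 * β)) p :=
      hc.norm.rpow_const (Or.inl (by simpa using hcp))
    refine h.mono_of_le (C := ENNReal.ofReal (‖c p‖ ^ (-2 * β) + 1)) (by simp) ?_
    filter_upwards [hcont.eventually_lt continuousAt_const (lt_add_one _)] with y hy
    rw [dens, dens, norm_mul, Real.mul_rpow (norm_nonneg _) (norm_nonneg _),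
      ENNReal.ofReal_mul (by positivity), mul_left_comm (ENNReal.ofReal (_ + _)),
      mul_comm (ENNReal.ofReal (‖F y‖ ^ (-2 * β)))]
    gcongr
  refine ⟨fun h => ?_, main F c hc hcp⟩
  have h1 := main (fun y => F y * c y) (fun y => (c y)⁻¹) (hc.inv₀ hcp) (inv_ne_zero hcp) h
  refine h1.mono_of_le (C := 1) (by simp) ?_
  filter_upwards [hc.eventually_ne hcp] with y hy
  simp [dens, hy]

/-- Local finiteness is inherited by smaller exponents. -/
lemma LocFin.anti_exponent [OpensMeasurableSpace A] {μ : Measure A} {f g : A → ℂ} {p : A}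
    (hf : ContinuousAt f p) {β α : ℝ} (hβ : 0 < β) (hβα : β ≤ α)
    (h : LocFin μ (dens f g α) p) : LocFin μ (dens f g β) p := by
  refine h.mono_of_le (C := ENNReal.ofReal ((‖f p‖ + 1) ^ (2 * (α - β)))) (by simp) ?_
  filter_upwards [hf.norm.eventually_lt continuousAt_const (lt_add_one _)] with y hy
  exact dens_le_of_le hβ hβα hy.le

end LocalFiniteness

/-- The jumping condition expressed with `[0, ∞]`-valued densities. -/
lemma jumpingAtOf_iff {k : ℕ} {f : (Fin k → ℂ) → ℂ} (hf : Measurable f) {α : ℝ}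
    {x : Fin k → ℂ} :
    JumpingAtOf f α x ↔ ∃ g : (Fin k → ℂ) → ℂ, Measurable g ∧
      (∀ᶠ y in 𝓝 x, DifferentiableAt ℂ g y) ∧
      (∀ β, 0 < β → β < α → LocFin volume (dens f g β) x) ∧
      ¬ LocFin volume (dens f g α) x := by
  have key : ∀ (g : (Fin k → ℂ) → ℂ), Measurable g → ∀ (β : ℝ) (W : Set (Fin k → ℂ)),
      IntegrableOn (fun y => ‖g y‖ ^ 2 * ‖f y‖ ^ (-2 * β)) W ↔
        ∫⁻ y in W, dens f g β y < ⊤ := by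
    intro g hg β W
    simp_rw [dens_eq_ofReal]
    rw [← hasFiniteIntegral_iff_ofReal (ae_of_all _ fun y => by positivity)]
    have hmeas : Measurable fun y => ‖g y‖ ^ 2 * ‖f y‖ ^ (-2 * β) := by fun_prop
    exact ⟨fun h => h.2, fun h => ⟨hmeas.aestronglyMeasurable, h⟩⟩
  constructor
  · rintro ⟨U, g, hU, hg, h1, h2⟩
    obtain ⟨O, hOU, hO, hxO⟩ := mem_nhds_iff.1 hU
    have hmeas : Measurable (O.piecewise g 0) :=
      ContinuousOn.measurable_piecewise (hg.mono hOU).continuousOn continuousOn_const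
        hO.measurableSet
    have hint : ∀ (β : ℝ) (W : Set (Fin k → ℂ)), MeasurableSet W → W ⊆ O →
        (IntegrableOn (fun y => ‖O.piecewise g 0 y‖ ^ 2 * ‖f y‖ ^ (-2 * β)) W ↔
          IntegrableOn (fun y => ‖g y‖ ^ 2 * ‖f y‖ ^ (-2 * β)) W) := by
      intro β W hWm hW
      refine integrableOn_congr_fun (fun y hy => ?_) hWm
      simp [Set.piecewise_eq_of_mem _ _ _ (hW hy)]
    refine ⟨O.piecewise g 0, hmeas, ?_, ?_, ?_⟩
    · filter_upwards [hO.mem_nhds hxO] with y hy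
      refine ((hg.mono hOU).differentiableAt (hO.mem_nhds hy)).congr_of_eventuallyEq ?_
      filter_upwards [hO.mem_nhds hy] with z hz using Set.piecewise_eq_of_mem _ _ _ hz
    · intro β h0 hβ
      obtain ⟨W, hW, hfin⟩ := h1 β h0 hβ
      obtain ⟨W', hW', hW'o, hxW'⟩ := mem_nhds_iff.1 hW
      refine ⟨W' ∩ O, (hW'o.inter hO).mem_nhds ⟨hxW', hxO⟩, ?_⟩
      rw [← key _ hmeas, hint β _ (hW'o.inter hO).measurableSet inter_subset_right]
      exact hfin.mono_set (inter_subset_left.trans hW')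
    · rintro ⟨W, hW, hfin⟩
      obtain ⟨W', hW', hW'o, hxW'⟩ := mem_nhds_iff.1 hW
      refine h2 (W' ∩ O) ((hW'o.inter hO).mem_nhds ⟨hxW', hxO⟩) ?_
      rw [← hint α _ (hW'o.inter hO).measurableSet inter_subset_right, key _ hmeas]
      exact (lintegral_mono_set (inter_subset_left.trans hW')).trans_lt hfin
  · rintro ⟨g, hg, hd, h1, h2⟩
    refine ⟨_, g, hd, fun y hy => DifferentiableAt.differentiableWithinAt hy, ?_, ?_⟩
    · intro β h0 hβ
      obtain ⟨W, hW, hfin⟩ := h1 β h0 hβ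
      exact ⟨W, hW, (key g hg β W).2 hfin⟩
    · intro W hW h
      exact h2 ⟨W, hW, (key g hg α W).1 h⟩

section OneVariable

/-- A consequence of Cauchy's formula applied to `ψ²`. -/
lemma enorm_sq_le_lintegral_circle {ψ : ℂ → ℂ} (hψ : DiffContOnCl ℂ ψ (Metric.ball 0 1)) {t : ℂ}
    (ht : ‖t‖ ≤ 1 / 2) :
    ‖ψ t‖ₑ ^ 2 ≤ ENNReal.ofReal (1 / Real.pi) *
      ∫⁻ θ in Ioc 0 (2 * Real.pi), ‖ψ (circleMap 0 1 θ)‖ₑ ^ 2 := by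
  have hψ2 : DiffContOnCl ℂ (fun z => ψ z • ψ z) (Metric.ball 0 1) := hψ.smul hψ
  have hmem : t ∈ Metric.ball (0 : ℂ) 1 := by
    rw [mem_ball_zero_iff]; linarith
  have h := hψ2.two_pi_i_inv_smul_circleIntegral_sub_inv_smul hmem
  have h2 : ‖ψ t‖ₑ ^ 2 = ‖ψ t • ψ t‖ₑ := by rw [enorm_smul, sq]
  rw [h2, ← h, enorm_smul, circleIntegral, intervalIntegral.integral_of_le Real.two_pi_pos.le]
  have hconst : ‖(2 * (Real.pi : ℂ) * Complex.I)⁻¹‖ₑ * 2 = ENNReal.ofReal (1 / Real.pi) := by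
    rw [← ofReal_norm, show (2 : ℝ≥0∞) = ENNReal.ofReal 2 by simp,
      ← ENNReal.ofReal_mul (norm_nonneg _)]
    congr 1
    simp [abs_of_pos Real.pi_pos]
  rw [← hconst, mul_assoc _ (2 : ℝ≥0∞)]
  gcongr
  refine le_trans (enorm_integral_le_lintegral_enorm _) ?_
  rw [← lintegral_const_mul' _ _ (by simp)]
  refine lintegral_mono fun θ => ?_
  have hz : ‖circleMap 0 1 θ‖ = 1 := by simp
  have hinv : ‖(circleMap 0 1 θ - t)⁻¹‖ₑ ≤ 2 := by
    rw [← ofReal_norm, show (2 : ℝ≥0∞) = ENNReal.ofReal 2 by simp]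
    refine ENNReal.ofReal_le_ofReal ?_
    have := norm_sub_norm_le (circleMap 0 1 θ) t
    rw [norm_inv]
    exact inv_le_of_inv_le₀ (by norm_num) (by norm_num; linarith)
  have hder : ‖deriv (circleMap 0 1) θ‖ₑ = 1 := by
    rw [← ofReal_norm]; simp
  rw [enorm_smul, enorm_smul, enorm_smul, hder, one_mul, sq]
  gcongr

lemma enorm_sq_le_of_le_analyticOrderAt {φ : ℂ → ℂ} {K : ℕ}
    (hφ : ∀ t ∈ Metric.closedBall (0 : ℂ) 1, DifferentiableAt ℂ φ t)
    (h0 : AnalyticAt ℂ φ 0) (hK : K ≤ analyticOrderAt φ 0) {t : ℂ} (ht : ‖t‖ ≤ 1 / 2) :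
    ‖φ t‖ₑ ^ 2 ≤ ENNReal.ofReal (‖t‖ ^ (2 * K)) * (ENNReal.ofReal (1 / Real.pi) *
      ∫⁻ θ in Ioc 0 (2 * Real.pi), ‖φ (circleMap 0 1 θ)‖ₑ ^ 2) := by
  obtain ⟨g, hg, hφg⟩ := (natCast_le_analyticOrderAt h0).1 hK
  set ψ : ℂ → ℂ := fun z => if z = 0 then g 0 else φ z / z ^ K with hψdef
  have hφψ : ∀ z, φ z = z ^ K * ψ z := by
    intro z
    rcases eq_or_ne z 0 with rfl | hz
    · simpa [hψdef] using hφg.self_of_nhds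
    · simp [hψdef, hz, mul_div_cancel₀]
  have hψg : ψ =ᶠ[𝓝 0] g := by
    filter_upwards [hφg] with z hz
    rcases eq_or_ne z 0 with rfl | hz0
    · simp [hψdef]
    · simp only [sub_zero, smul_eq_mul] at hz
      simp [hψdef, hz0, hz]
  have hψd : ∀ z ∈ Metric.closedBall (0 : ℂ) 1, DifferentiableAt ℂ ψ z := by
    intro z hz
    rcases eq_or_ne z 0 with rfl | hz0
    · exact hg.differentiableAt.congr_of_eventuallyEq hψg
    · refine ((hφ z hz).div (differentiableAt_id.pow K)
        (pow_ne_zero _ hz0)).congr_of_eventuallyEq ?_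
      filter_upwards [isOpen_ne.mem_nhds hz0] with w hw
      simp only [hψdef, if_neg hw]
      rfl
  have hcl : DiffContOnCl ℂ ψ (Metric.ball 0 1) := by
    refine DifferentiableOn.diffContOnCl fun z hz => ?_
    rw [closure_ball (0 : ℂ) one_ne_zero] at hz
    exact (hψd z hz).differentiableWithinAt
  have := enorm_sq_le_lintegral_circle hcl ht
  rw [hφψ t, enorm_mul, mul_pow, enorm_pow, ← pow_mul, mul_comm K,
    ENNReal.ofReal_pow (norm_nonneg _), ofReal_norm]
  gcongr
  refine this.trans_eq ?_
  congr 1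
  refine lintegral_congr fun θ => ?_
  rw [hφψ, enorm_mul, enorm_pow, ← ofReal_norm (circleMap 0 1 θ)]
  simp

end OneVariable

section Homogeneous

variable {γ : ℕ}

/-- The order of vanishing at `0` of `h` along the line through `u` exceeds `s`. -/
def OrdGT (h : (Fin γ → ℂ) → ℂ) (s : ℝ) (u : Fin γ → ℂ) : Prop :=
  ∀ k : ℕ, analyticOrderAt (fun t : ℂ => h (t • u)) 0 = k → s < k

lemma analyticAt_line {h : (Fin γ → ℂ) → ℂ} (hd : ∀ᶠ y in 𝓝 0, DifferentiableAt ℂ h y)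
    (u : Fin γ → ℂ) : AnalyticAt ℂ (fun t : ℂ => h (t • u)) 0 := by
  have hc : Tendsto (fun t : ℂ => t • u) (𝓝 0) (𝓝 0) :=
    Continuous.tendsto' (by fun_prop) _ _ (by simp)
  rw [Complex.analyticAt_iff_eventually_differentiableAt]
  filter_upwards [hc.eventually hd] with t ht
  exact ht.comp t (by fun_prop : DifferentiableAt ℂ (fun t : ℂ => t • u) t)

lemma setLIntegral_preimage_smul {Φ : (Fin γ → ℂ) → ℝ≥0∞} (hΦ : Measurable Φ)
    {S : Set (Fin γ → ℂ)} (hS : MeasurableSet S) {ρ : ℝ} (hρ : 0 < ρ) :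
    ∫⁻ y in (fun u => ρ⁻¹ • u) ⁻¹' S, Φ y =
      ENNReal.ofReal (ρ ^ (2 * γ)) * ∫⁻ u in S, Φ (ρ • u) := by
  have hfin : Module.finrank ℝ (Fin γ → ℂ) = 2 * γ := by
    simp [Module.finrank_pi_fintype, mul_comm]
  have hmap := Measure.map_addHaar_smul (volume : Measure (Fin γ → ℂ)) (inv_pos.2 hρ).ne'
  have := setLIntegral_map (μ := (volume : Measure (Fin γ → ℂ))) hS
    (f := fun u => Φ (ρ • u)) (by fun_prop) (measurable_const_smul ρ⁻¹)
  rw [hmap, hfin, Measure.restrict_smul, lintegral_smul_measure] at this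
  simp only [smul_inv_smul₀ hρ.ne'] at this
  rw [← this, smul_eq_mul]
  congr 2
  rw [abs_of_pos (by positivity), inv_pow, inv_inv]

lemma measurePreserving_smul_of_norm_eq_one {c : ℂ} (hc : ‖c‖ = 1) :
    MeasurePreserving (fun u : Fin γ → ℂ => c • u) volume volume := by
  have h : MeasurePreserving (fun z : ℂ => c * z) volume volume :=
    (rotation ⟨c, by simpa [Submonoid.unitSphere] using hc⟩).measurePreserving
  exact volume_preserving_pi (fun _ : Fin γ => h)

lemma dens_smul {F h : (Fin γ → ℂ) → ℂ} {d : ℕ} (hF : ∀ (c : ℂ) u, F (c • u) = c ^ d * F u)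
    (β : ℝ) (c : ℂ) (u : Fin γ → ℂ) :
    dens F h β (c • u) = ENNReal.ofReal (‖c‖ ^ (-2 * (d * β))) *
      (‖h (c • u)‖ₑ ^ 2 * ENNReal.ofReal (‖F u‖ ^ (-2 * β))) := by
  rw [dens, hF, norm_mul, norm_pow, Real.mul_rpow (by positivity) (norm_nonneg _),
    ENNReal.ofReal_mul (by positivity), ← Real.rpow_natCast_mul (norm_nonneg _), mul_left_comm,
    mul_left_comm (d : ℝ)]

lemma dens_real_smul {F h : (Fin γ → ℂ) → ℂ} {d : ℕ}
    (hF : ∀ (c : ℂ) u, F (c • u) = c ^ d * F u) (β : ℝ) {ρ : ℝ} (hρ : 0 < ρ) (u : Fin γ → ℂ) :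
    ENNReal.ofReal (ρ ^ (2 * γ)) * dens F h β (ρ • u) =
      ENNReal.ofReal (ρ ^ (2 * (γ - d * β))) *
      (‖h ((ρ : ℂ) • u)‖ₑ ^ 2 * ENNReal.ofReal (‖F u‖ ^ (-2 * β))) := by
  have h1 : ρ • u = (ρ : ℂ) • u := (Complex.coe_smul ρ u).symm
  rw [h1, dens_smul hF, ← mul_assoc, ← ENNReal.ofReal_mul (by positivity)]
  congr 2
  rw [Complex.norm_real, Real.norm_of_nonneg hρ.le, ← Real.rpow_natCast, ← Real.rpow_add hρ]
  push_cast
  ring_nf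

/-- Integrability of `|h|² |F|^(-2β)` at the origin bounds from below the order of vanishing of
`h` along almost every line. -/
lemma ae_ordGT_of_locFin (hγ : 0 < γ) {F h : (Fin γ → ℂ) → ℂ} {d : ℕ} (hFm : Measurable F)
    (hF : ∀ (c : ℂ) u, F (c • u) = c ^ d * F u) (hF0 : ∀ᵐ u, F u ≠ 0) (hm : Measurable h)
    (hd : ∀ᶠ y in 𝓝 0, DifferentiableAt ℂ h y) {β : ℝ} (hfin : LocFin volume (dens F h β) 0) :
    ∀ᵐ u, OrdGT h (d * β - γ) u := by
  obtain ⟨W, hW, hfin⟩ := hfin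
  obtain ⟨ε, hε, hεW⟩ := Metric.mem_nhds_iff.1 hW
  have hΦm := dens_measurable hFm hm β
  set ρ : ℕ → ℝ := fun j => (1 / 2) ^ j with hρdef
  have hρ : ∀ j, 0 < ρ j := fun j => by positivity
  have hρlim : Tendsto ρ atTop (𝓝 0) :=
    tendsto_pow_atTop_nhds_zero_of_lt_one (by norm_num) (by norm_num)
  set a : ℕ → (Fin γ → ℂ) → ℝ≥0∞ := fun j u =>
    ENNReal.ofReal (ρ j ^ (2 * γ)) * dens F h β (ρ j • u) with hadef
  have ham : ∀ j, Measurable (a j) := fun j =>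
    (hΦm.comp (measurable_const_smul (ρ j))).const_mul _
  have hliminf : ∀ᵐ u, liminf (fun j => a j u) atTop = 0 := by
    have hball : ∀ R : ℕ, ∀ᵐ u, u ∈ Metric.closedBall (0 : Fin γ → ℂ) R →
        liminf (fun j => a j u) atTop = 0 := by
      intro R
      rw [← ae_restrict_iff' Metric.isClosed_closedBall.measurableSet]
      set S := Metric.closedBall (0 : Fin γ → ℂ) R
      have hSm : MeasurableSet S := Metric.isClosed_closedBall.measurableSet
      have hint : ∀ j, ∫⁻ u in S, a j u =
          ∫⁻ y in (fun u => (ρ j)⁻¹ • u) ⁻¹' S, dens F h β y := by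
        intro j
        rw [setLIntegral_preimage_smul hΦm hSm (hρ j)]
        exact lintegral_const_mul' _ _ (by simp)
      have hvol : Tendsto (fun j => volume ((fun u => (ρ j)⁻¹ • u) ⁻¹' S)) atTop (𝓝 0) := by
        have h1 : ∀ j, volume ((fun u : Fin γ → ℂ => (ρ j)⁻¹ • u) ⁻¹' S) =
            ENNReal.ofReal (ρ j ^ (2 * γ)) * volume S := by
          intro j
          simpa using setLIntegral_preimage_smul (Φ := 1) measurable_one hSm (hρ j)
        simp_rw [h1]
        have h2 : Tendsto (fun j => ENNReal.ofReal (ρ j ^ (2 * γ))) atTop (𝓝 0) := by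
          have := ENNReal.tendsto_ofReal (hρlim.pow (2 * γ))
          rwa [zero_pow (by omega), ENNReal.ofReal_zero] at this
        simpa using ENNReal.Tendsto.mul_const h2
          (Or.inr (isCompact_closedBall _ _).measure_lt_top.ne)
      have hlim : Tendsto (fun j => ∫⁻ u in S, a j u) atTop (𝓝 0) := by
        have h1 : Tendsto (fun j => ∫⁻ y in (fun u => (ρ j)⁻¹ • u) ⁻¹' S, dens F h β y
            ∂(volume.restrict W)) atTop (𝓝 0) := by
          refine tendsto_setLIntegral_zero hfin.ne ?_
          exact tendsto_of_tendsto_of_tendsto_of_le_of_le tendsto_const_nhds hvol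
            (fun _ => zero_le) fun _ => Measure.restrict_apply_le _ _
        refine h1.congr' ?_
        have h2 : Tendsto (fun j => ρ j * R) atTop (𝓝 0) := by simpa using hρlim.mul_const (R : ℝ)
        filter_upwards [h2.eventually (gt_mem_nhds hε)] with j hj
        rw [hint, Measure.restrict_restrict (measurable_const_smul _ hSm), inter_eq_left.2]
        intro y hy
        refine hεW ?_
        have h3 : ‖(ρ j)⁻¹ • y‖ ≤ R := by simpa [S] using hy
        rw [norm_smul, norm_inv, Real.norm_of_nonneg (hρ j).le, inv_mul_le_iff₀ (hρ j)] at h3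
        simpa using h3.trans_lt hj
      have hzero : ∫⁻ u in S, liminf (fun j => a j u) atTop = 0 :=
        le_antisymm ((lintegral_liminf_le ham).trans hlim.liminf_eq.le) zero_le
      exact (lintegral_eq_zero_iff (Measurable.liminf ham)).1 hzero
    filter_upwards [ae_all_iff.2 hball] with u hu
    obtain ⟨R, hR⟩ := exists_nat_ge ‖u‖
    exact hu R (by simpa using hR)
  filter_upwards [hliminf, hF0] with u hu hFu k hk
  by_contra! hle
  obtain ⟨ψ, hψ, hψ0, heq⟩ := ((analyticAt_line hd u).analyticOrderAt_eq_natCast).1 hk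
  have hψc : Tendsto (fun j => ‖ψ ((ρ j : ℝ) : ℂ)‖ₑ ^ 2) atTop (𝓝 (‖ψ 0‖ₑ ^ 2)) := by
    have h1 : Tendsto (fun j => ((ρ j : ℝ) : ℂ)) atTop (𝓝 0) := by
      simpa [Function.comp_def] using (Complex.continuous_ofReal.tendsto 0).comp hρlim
    exact ((ENNReal.continuous_pow 2).tendsto _).comp
      ((hψ.continuousAt.enorm.tendsto).comp h1)
  have hge : ∀ᶠ j in atTop, ‖ψ ((ρ j : ℝ) : ℂ)‖ₑ ^ 2 * ENNReal.ofReal (‖F u‖ ^ (-2 * β)) ≤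
      a j u := by
    have h1 : Tendsto (fun j => ((ρ j : ℝ) : ℂ)) atTop (𝓝 0) := by
      simpa [Function.comp_def] using (Complex.continuous_ofReal.tendsto 0).comp hρlim
    filter_upwards [h1.eventually heq] with j hj
    rw [hadef]
    simp only
    rw [dens_real_smul hF β (hρ j), hj, sub_zero, smul_eq_mul, enorm_mul, mul_pow, enorm_pow,
      ← ofReal_norm (ρ j : ℂ), Complex.norm_real, Real.norm_of_nonneg (hρ j).le, mul_assoc,
      ← mul_assoc, ← ENNReal.ofReal_pow (hρ j).le, ← ENNReal.ofReal_pow (by positivity),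
      ← ENNReal.ofReal_mul (Real.rpow_nonneg (hρ j).le _), ← pow_mul, ← Real.rpow_natCast (ρ j),
      ← Real.rpow_add (hρ j)]
    refine le_mul_of_one_le_left' ?_
    rw [← ENNReal.ofReal_one]
    refine ENNReal.ofReal_le_ofReal ?_
    refine Real.one_le_rpow_of_pos_of_le_one_of_nonpos (hρ j)
      (pow_le_one₀ (by norm_num) (by norm_num)) ?_
    push_cast
    linarith
  have hlim := ENNReal.Tendsto.mul_const (b := ENNReal.ofReal (‖F u‖ ^ (-2 * β))) hψc
    (Or.inr ENNReal.ofReal_ne_top)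
  have hle' := liminf_le_liminf hge
  rw [hlim.liminf_eq, hu, nonpos_iff_eq_zero] at hle'
  have hpos : 0 < ‖F u‖ ^ (-2 * β) := Real.rpow_pos_of_pos (norm_pos_iff.2 hFu) _
  simp only [mul_eq_zero, ENNReal.ofReal_eq_zero, hpos.not_ge, or_false] at hle'
  simp [hψ0] at hle'

/-- The shell `r / 2 ≤ ‖u‖ ≤ r`. -/
def shell (γ : ℕ) (r : ℝ) : Set (Fin γ → ℂ) := {u | r / 2 ≤ ‖u‖ ∧ ‖u‖ ≤ r}

lemma isCompact_shell (r : ℝ) : IsCompact (shell γ r) := by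
  refine (isCompact_closedBall (0 : Fin γ → ℂ) r).of_isClosed_subset ?_ fun u hu => by
    simpa using hu.2
  exact (isClosed_le continuous_const continuous_norm).inter
    (isClosed_le continuous_norm continuous_const)

/-- If `h` vanishes to high order along almost every line, the integral of `|h|² |F|^(-2α)` over a
ball is controlled by the integral over a shell, uniformly in `h`. -/
lemma exists_setLIntegral_closedBall_le (hγ : 0 < γ) {F : (Fin γ → ℂ) → ℂ} {d : ℕ}
    (hFm : Measurable F) (hF : ∀ (c : ℂ) u, F (c • u) = c ^ d * F u) (α : ℝ) :
    ∃ C : ℝ≥0∞, C ≠ ⊤ ∧ ∀ (h : (Fin γ → ℂ) → ℂ) (r : ℝ), Measurable h → 0 < r →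
      (∀ y ∈ Metric.closedBall 0 r, DifferentiableAt ℂ h y) →
      (∀ᶠ y in 𝓝 0, DifferentiableAt ℂ h y) →
      (∀ᵐ u, OrdGT h (d * α - γ) u) →
      ∫⁻ u in Metric.closedBall 0 r, dens F h α u ≤ C * ∫⁻ u in shell γ r, dens F h α u := by
  obtain ⟨K, hK, hKmin⟩ : ∃ K : ℕ, d * α - γ < K ∧ ∀ k : ℕ, d * α - γ < k → K ≤ k :=
    ⟨Nat.find (exists_nat_gt (d * α - γ)), Nat.find_spec (exists_nat_gt (d * α - γ)),
      fun k hk => Nat.find_min' _ hk⟩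
  set e : ℝ := 2 * K + 2 * (γ - d * α) with he
  have hepos : 0 < e := by linarith
  set q : ℝ := (1 / 2) ^ e with hq
  have hq0 : 0 < q := by positivity
  have hq1 : q < 1 := Real.rpow_lt_one (by norm_num) (by norm_num) hepos
  have hsum : ∑' j : ℕ, 2 * ENNReal.ofReal q ^ j ≠ ⊤ := by
    rw [ENNReal.tsum_mul_left, ENNReal.tsum_geometric]
    refine ENNReal.mul_ne_top (by simp) (ENNReal.inv_ne_top.2 ?_)
    exact (tsub_pos_of_lt (by simpa using hq1)).ne'
  refine ⟨_, hsum, fun h r hm hr hd hd0 hord => ?_⟩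
  have hΦm := dens_measurable hFm hm α
  set ρ : ℕ → ℝ := fun j => (1 / 2) ^ j with hρdef
  have hρ : ∀ j, 0 < ρ j := fun j => by positivity
  have hAm : MeasurableSet (shell γ r) := (isCompact_shell r).measurableSet
  have hrot : ∀ θ : ℝ, ∫⁻ u in shell γ r, dens F h α (circleMap 0 1 θ • u) =
      ∫⁻ u in shell γ r, dens F h α u := by
    intro θ
    have hc : ‖circleMap 0 1 θ‖ = 1 := by simp
    have hmp := measurePreserving_smul_of_norm_eq_one (γ := γ) hc
    have hpre : (fun u : Fin γ → ℂ => circleMap 0 1 θ • u) ⁻¹' shell γ r = shell γ r := by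
      ext u
      simp [shell, norm_smul]
    have := hmp.setLIntegral_comp_preimage hAm hΦm
    rwa [hpre] at this
  have hbound : ∀ j, ∫⁻ y in (fun u => (ρ j)⁻¹ • u) ⁻¹' shell γ r, dens F h α y ≤
      2 * ENNReal.ofReal q ^ j * ∫⁻ u in shell γ r, dens F h α u := by
    intro j
    rcases Nat.eq_zero_or_pos j with rfl | hj
    · simp only [hρdef, pow_zero, inv_one, one_smul, mul_one, preimage_id']
      exact le_mul_of_one_le_left' (by norm_num)
    rw [setLIntegral_preimage_smul hΦm hAm (hρ j), ← lintegral_const_mul' _ _ (by simp)]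
    have hpt : ∀ᵐ u, u ∈ shell γ r → ENNReal.ofReal (ρ j ^ (2 * γ)) * dens F h α (ρ j • u) ≤
        ENNReal.ofReal q ^ j * (ENNReal.ofReal (1 / Real.pi) *
          ∫⁻ θ in Ioc 0 (2 * Real.pi), dens F h α (circleMap 0 1 θ • u)) := by
      filter_upwards [hord] with u hu huA
      have hle : (K : ℕ∞) ≤ analyticOrderAt (fun t : ℂ => h (t • u)) 0 := by
        rcases eq_or_ne (analyticOrderAt (fun t : ℂ => h (t • u)) 0) ⊤ with h1 | h1
        · simp [h1]
        · obtain ⟨k, hk⟩ := ENat.ne_top_iff_exists.1 h1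
          rw [← hk]
          exact_mod_cast hKmin k (hu k hk.symm)
      have hline : ∀ t ∈ Metric.closedBall (0 : ℂ) 1,
          DifferentiableAt ℂ (fun t : ℂ => h (t • u)) t := by
        intro t ht
        refine (hd (t • u) ?_).comp t (by fun_prop : DifferentiableAt ℂ (fun t : ℂ => t • u) t)
        rw [mem_closedBall_zero_iff] at ht ⊢
        rw [norm_smul]
        exact (mul_le_of_le_one_left (norm_nonneg _) ht).trans huA.2
      have hρ2 : ‖((ρ j : ℝ) : ℂ)‖ ≤ 1 / 2 := by
        rw [Complex.norm_real, Real.norm_of_nonneg (hρ j).le]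
        exact pow_le_of_le_one (by norm_num) (by norm_num) hj.ne'
      have hmain := enorm_sq_le_of_le_analyticOrderAt hline (analyticAt_line hd0 u) hle hρ2
      rw [Complex.norm_real, Real.norm_of_nonneg (hρ j).le] at hmain
      have hcirc : ∀ θ, dens F h α (circleMap 0 1 θ • u) =
          ‖h (circleMap 0 1 θ • u)‖ₑ ^ 2 * ENNReal.ofReal (‖F u‖ ^ (-2 * α)) := by
        intro θ
        rw [dens_smul hF]
        simp
      simp_rw [hcirc]
      rw [lintegral_mul_const' _ _ (by simp), dens_real_smul hF α (hρ j)]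
      calc _ ≤ ENNReal.ofReal (ρ j ^ (2 * (γ - d * α))) *
            (ENNReal.ofReal (ρ j ^ (2 * K)) * (ENNReal.ofReal (1 / Real.pi) *
              ∫⁻ θ in Ioc 0 (2 * Real.pi), ‖h (circleMap 0 1 θ • u)‖ₑ ^ 2) *
              ENNReal.ofReal (‖F u‖ ^ (-2 * α))) := by gcongr
        _ = ENNReal.ofReal (ρ j ^ (2 * (γ - d * α)) * ρ j ^ (2 * K)) *
            (ENNReal.ofReal (1 / Real.pi) *
              ((∫⁻ θ in Ioc 0 (2 * Real.pi), ‖h (circleMap 0 1 θ • u)‖ₑ ^ 2) *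
              ENNReal.ofReal (‖F u‖ ^ (-2 * α)))) := by
            rw [ENNReal.ofReal_mul (Real.rpow_nonneg (hρ j).le _)]
            ring
        _ = _ := by
            rw [← ENNReal.ofReal_pow hq0.le]
            congr 2
            rw [← Real.rpow_natCast (ρ j), ← Real.rpow_add (hρ j), hρdef, hq]
            simp only
            rw [← Real.rpow_natCast_mul (by norm_num), ← Real.rpow_mul_natCast (by norm_num), he]
            congr 1
            push_cast
            ring
    refine (setLIntegral_mono_ae' hAm hpt).trans ?_
    rw [lintegral_const_mul' _ _ (by simp), lintegral_const_mul' _ _ (by simp),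
      lintegral_lintegral_swap, lintegral_congr hrot, lintegral_const]
    · rw [Measure.restrict_apply_univ, Real.volume_Ioc, sub_zero, mul_left_comm (ENNReal.ofReal _),
        ← ENNReal.ofReal_mul (by positivity), mul_comm (∫⁻ u in shell γ r, dens F h α u) ,
        ← mul_assoc]
      refine le_of_eq ?_
      congr 1
      rw [mul_comm]
      congr 1
      rw [show 1 / Real.pi * (2 * Real.pi) = 2 by field_simp]
      simp
    · refine (hΦm.comp ?_).aemeasurable
      fun_prop
  have hcover : Metric.closedBall (0 : Fin γ → ℂ) r ⊆
      {0} ∪ ⋃ j, (fun u => (ρ j)⁻¹ • u) ⁻¹' shell γ r := by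
    intro u hu
    rw [mem_closedBall_zero_iff] at hu
    rcases eq_or_ne u 0 with rfl | hu0
    · simp
    right
    have hn : 0 < ‖u‖ := norm_pos_iff.2 hu0
    obtain ⟨j, hj1, hj2⟩ := exists_nat_pow_near_of_lt_one (x := ‖u‖ / r) (y := 1 / 2)
      (by positivity) ((div_le_one hr).2 hu) (by norm_num) (by norm_num)
    refine mem_iUnion.2 ⟨j, ?_⟩
    have h3 : ‖(ρ j)⁻¹ • u‖ = (ρ j)⁻¹ * ‖u‖ := by
      rw [norm_smul, norm_inv, Real.norm_of_nonneg (hρ j).le]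
    rw [pow_succ] at hj1
    change (ρ j) * (1 / 2) < _ at hj1
    change _ ≤ ρ j at hj2
    rw [div_le_iff₀ hr] at hj2
    rw [lt_div_iff₀ hr] at hj1
    simp only [shell, mem_preimage, mem_ofPred_eq, h3]
    constructor
    · rw [le_inv_mul_iff₀ (hρ j)]
      linarith
    · rwa [inv_mul_le_iff₀ (hρ j)]
  have : Nonempty (Fin γ) := ⟨⟨0, hγ⟩⟩
  calc ∫⁻ u in Metric.closedBall 0 r, dens F h α u
      ≤ ∫⁻ u in {0} ∪ ⋃ j, (fun u => (ρ j)⁻¹ • u) ⁻¹' shell γ r, dens F h α u :=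
        lintegral_mono_set hcover
    _ ≤ (∫⁻ u in {0}, dens F h α u) +
          ∫⁻ u in ⋃ j, (fun u => (ρ j)⁻¹ • u) ⁻¹' shell γ r, dens F h α u :=
        lintegral_union_le _ _ _
    _ ≤ 0 + ∑' j, ∫⁻ y in (fun u => (ρ j)⁻¹ • u) ⁻¹' shell γ r, dens F h α y := by
        gcongr
        · simp
        · exact lintegral_iUnion_le _ _
    _ ≤ ∑' j, 2 * ENNReal.ofReal q ^ j * ∫⁻ u in shell γ r, dens F h α u := by
        rw [zero_add]
        exact ENNReal.tsum_le_tsum hbound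
    _ = _ := ENNReal.tsum_mul_right

end Homogeneous

lemma mem_closedBall_prod {γ : ℕ} {Y : Type*} [NormedAddCommGroup Y] {r : ℝ} {u : Fin γ → ℂ} {v : Y}
    (hu : u ∈ Metric.closedBall 0 r) (hv : v ∈ Metric.closedBall 0 r) :
    (u, v) ∈ Metric.closedBall (0 : (Fin γ → ℂ) × Y) r := by
  rw [← Prod.mk_zero_zero, ← closedBall_prod_same]
  exact ⟨hu, hv⟩

lemma differentiableAt_slice {γ : ℕ} {Y : Type*} [NormedAddCommGroup Y] [NormedSpace ℂ Y]
    {G : (Fin γ → ℂ) × Y → ℂ} {p : (Fin γ → ℂ) × Y} (h : DifferentiableAt ℂ G p) :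
    DifferentiableAt ℂ (fun u => G (u, p.2)) p.1 :=
  DifferentiableAt.comp (g := G) p.1 h
    (by fun_prop : DifferentiableAt ℂ (fun u : Fin γ → ℂ => (u, p.2)) p.1)

lemma setLIntegral_shell_prod_lt_top {γ : ℕ} {Y : Type*} [NormedAddCommGroup Y] [ProperSpace Y]
    [MeasurableSpace Y] {ν : Measure Y} {r : ℝ} (hr : 0 < r) {Φ : (Fin γ → ℂ) × Y → ℝ≥0∞}
    (h : ∀ p ∈ Metric.closedBall (0 : (Fin γ → ℂ) × Y) r, p.1 ≠ 0 →
      LocFin (volume.prod ν) Φ p) :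
    ∫⁻ p in shell γ r ×ˢ Metric.closedBall 0 r, Φ p ∂(volume.prod ν) < ⊤ := by
  refine ((isCompact_shell r).prod (isCompact_closedBall 0 r)).setLIntegral_lt_top_of_locFin
    fun p hp => h p (mem_closedBall_prod (by simpa using hp.1.2) hp.2) fun h0 => ?_
  have := hp.1.1
  rw [h0, norm_zero] at this
  linarith

lemma exists_closedBall_forall {γ : ℕ} {Y : Type*} [NormedAddCommGroup Y] [MeasurableSpace Y]
    {ν : Measure Y} {P Q : (Fin γ → ℂ) × Y → Prop} {Φ : (Fin γ → ℂ) × Y → ℝ≥0∞}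
    (hP : ∀ᶠ p in 𝓝 0, P p) (hQ : ∀ᶠ p in 𝓝 0, Q p) (hΦ : LocFin (volume.prod ν) Φ 0) :
    ∃ r : ℝ, 0 < r ∧ (∀ p ∈ Metric.closedBall 0 r, P p) ∧ (∀ p ∈ Metric.closedBall 0 r, Q p) ∧
      ∫⁻ p in Metric.closedBall 0 r, Φ p ∂(volume.prod ν) < ⊤ := by
  obtain ⟨W, hW, hfin⟩ := hΦ
  obtain ⟨r, hr, h⟩ := Metric.nhds_basis_closedBall.eventually_iff.1 ((hP.and hQ).and hW)
  exact ⟨r, hr, fun p hp => (h hp).1.1, fun p hp => (h hp).1.2,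
    (lintegral_mono_set fun p hp => (h hp).2).trans_lt hfin⟩

lemma setLIntegral_prod_dens {γ : ℕ} {Y : Type*} [MeasurableSpace Y] {ν : Measure Y} [SFinite ν]
    {F : (Fin γ → ℂ) → ℂ} {G : (Fin γ → ℂ) × Y → ℂ} (hFm : Measurable F)
    (hGm : Measurable G) (α : ℝ) (S : Set (Fin γ → ℂ)) (T : Set Y) :
    ∫⁻ p in S ×ˢ T, dens (fun p => F p.1) G α p ∂(volume.prod ν) =
      ∫⁻ v in T, (∫⁻ u in S, dens F (fun u => G (u, v)) α u) ∂ν := by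
  rw [← Measure.prod_restrict, lintegral_prod_symm']
  · rfl
  · exact dens_measurable (hFm.comp measurable_fst) hGm α

lemma eventually_differentiableAt_slice {γ : ℕ} {Y : Type*} [NormedAddCommGroup Y] [NormedSpace ℂ Y]
    {G : (Fin γ → ℂ) × Y → ℂ} {r : ℝ} (hr : 0 < r)
    (hd : ∀ p ∈ Metric.closedBall (0 : (Fin γ → ℂ) × Y) r, DifferentiableAt ℂ G p) {v : Y}
    (hv : v ∈ Metric.closedBall 0 r) :
    ∀ᶠ u in 𝓝 0, DifferentiableAt ℂ (fun u => G (u, v)) u := by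
  filter_upwards [Metric.closedBall_mem_nhds 0 hr] with u hu
  exact differentiableAt_slice (hd _ (mem_closedBall_prod hu hv))

section Product

variable {γ d : ℕ} {F : (Fin γ → ℂ) → ℂ}
  {Y : Type*} [NormedAddCommGroup Y] [NormedSpace ℂ Y] [ProperSpace Y] [MeasurableSpace Y]
  [BorelSpace Y] {ν : Measure Y} [ν.IsAddHaarMeasure] {G : (Fin γ → ℂ) × Y → ℂ}

lemma ae_ae_ordGT (hγ : 0 < γ) (hFm : Measurable F)
    (hF : ∀ (c : ℂ) u, F (c • u) = c ^ d * F u) (hF0 : ∀ᵐ u, F u ≠ 0) (hGm : Measurable G)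
    {r : ℝ} (hr : 0 < r)
    (hd : ∀ p ∈ Metric.closedBall (0 : (Fin γ → ℂ) × Y) r, DifferentiableAt ℂ G p) {β : ℝ}
    (hfin : ∫⁻ p in Metric.closedBall 0 r, dens (fun p => F p.1) G β p ∂(volume.prod ν) < ⊤) :
    ∀ᵐ v ∂ν.restrict (Metric.closedBall 0 r),
      ∀ᵐ u, OrdGT (fun u => G (u, v)) (d * β - γ) u := by
  rw [← Prod.mk_zero_zero, ← closedBall_prod_same, setLIntegral_prod_dens hFm hGm] at hfin
  have hmeas : Measurable fun v => ∫⁻ u in Metric.closedBall (0 : Fin γ → ℂ) r,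
      dens F (fun u => G (u, v)) β u :=
    (dens_measurable (hFm.comp measurable_fst) hGm β).lintegral_prod_left'
  filter_upwards [ae_lt_top hmeas hfin.ne,
    ae_restrict_mem Metric.isClosed_closedBall.measurableSet] with v hv hvB
  exact ae_ordGT_of_locFin hγ hFm hF hF0 (hGm.comp measurable_prodMk_right)
    (eventually_differentiableAt_slice hr hd hvB) ⟨_, Metric.closedBall_mem_nhds 0 hr, hv⟩

lemma setLIntegral_closedBall_lt_top (hγ : 0 < γ) (hFm : Measurable F)
    (hF : ∀ (c : ℂ) u, F (c • u) = c ^ d * F u) (hGm : Measurable G)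
    {r : ℝ} (hr : 0 < r)
    (hd : ∀ p ∈ Metric.closedBall (0 : (Fin γ → ℂ) × Y) r, DifferentiableAt ℂ G p) {α : ℝ}
    (hord : ∀ᵐ v ∂ν.restrict (Metric.closedBall 0 r),
      ∀ᵐ u, OrdGT (fun u => G (u, v)) (d * α - γ) u)
    (hshell : ∫⁻ p in shell γ r ×ˢ Metric.closedBall 0 r,
      dens (fun p => F p.1) G α p ∂(volume.prod ν) < ⊤) :
    ∫⁻ p in Metric.closedBall 0 r, dens (fun p => F p.1) G α p ∂(volume.prod ν) < ⊤ := by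
  obtain ⟨C, hC, hle⟩ := exists_setLIntegral_closedBall_le hγ hFm hF α
  rw [setLIntegral_prod_dens hFm hGm] at hshell
  rw [← Prod.mk_zero_zero, ← closedBall_prod_same, setLIntegral_prod_dens hFm hGm]
  refine lt_of_le_of_lt ?_ (ENNReal.mul_lt_top hC.lt_top hshell)
  rw [← lintegral_const_mul' _ _ hC]
  refine lintegral_mono_ae ?_
  filter_upwards [hord, ae_restrict_mem Metric.isClosed_closedBall.measurableSet] with v hv hvB
  exact hle _ r (hGm.comp measurable_prodMk_right) hr
    (fun u hu => differentiableAt_slice (hd _ (mem_closedBall_prod hu hvB)))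
    (eventually_differentiableAt_slice hr hd hvB) hv

/-- Extension of finiteness across the central fibre when no candidate exponent is crossed. -/
lemma locFin_of_gap (hγ : 0 < γ) (hFm : Measurable F)
    (hF : ∀ (c : ℂ) u, F (c • u) = c ^ d * F u) (hF0 : ∀ᵐ u, F u ≠ 0) (hGm : Measurable G)
    (hGd : ∀ᶠ p in 𝓝 0, DifferentiableAt ℂ G p) {β α : ℝ}
    (hgap : ∀ N : ℕ, d * β < N → d * α < N)
    (hβ : LocFin (volume.prod ν) (dens (fun p => F p.1) G β) 0)
    (hα : ∀ᶠ p in 𝓝 (0 : (Fin γ → ℂ) × Y), p.1 ≠ 0 →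
      LocFin (volume.prod ν) (dens (fun p => F p.1) G α) p) :
    LocFin (volume.prod ν) (dens (fun p => F p.1) G α) 0 := by
  obtain ⟨r, hr, hd, hloc, hfin⟩ := exists_closedBall_forall hGd hα hβ
  refine ⟨_, Metric.closedBall_mem_nhds 0 hr, setLIntegral_closedBall_lt_top hγ hFm hF hGm hr hd ?_
    (setLIntegral_shell_prod_lt_top hr hloc)⟩
  filter_upwards [ae_ae_ordGT hγ hFm hF hF0 hGm hr hd hfin] with v hv
  filter_upwards [hv] with u hu k hk
  have := hgap (k + γ) (by push_cast; linarith [hu k hk])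
  push_cast at this
  linarith

/-- If finiteness at exponent `α` fails only along the central fibre, then `α` is realized by a
slice, and `α` is at least `γ / d`. -/
lemma exists_slice_of_not_locFin (hγ : 0 < γ) (hFc : Continuous F)
    (hF : ∀ (c : ℂ) u, F (c • u) = c ^ d * F u) (hF0 : ∀ᵐ u, F u ≠ 0) (hGm : Measurable G)
    (hGd : ∀ᶠ p in 𝓝 0, DifferentiableAt ℂ G p) {β α : ℝ}
    (hgap : ∀ N : ℕ, d * β < N → d * α ≤ N)
    (hβ : LocFin (volume.prod ν) (dens (fun p => F p.1) G β) 0)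
    (hα : ∀ᶠ p in 𝓝 (0 : (Fin γ → ℂ) × Y), p.1 ≠ 0 →
      LocFin (volume.prod ν) (dens (fun p => F p.1) G α) p)
    (hnot : ¬ LocFin (volume.prod ν) (dens (fun p => F p.1) G α) 0) :
    γ ≤ d * α ∧ ∃ h : (Fin γ → ℂ) → ℂ, Measurable h ∧
      (∀ᶠ u in 𝓝 0, DifferentiableAt ℂ h u) ∧
      (∀ β', 0 < β' → β' < α → LocFin volume (dens F h β') 0) ∧
      ¬ LocFin volume (dens F h α) 0 := by
  have hFm := hFc.measurable
  obtain ⟨r, hr, hd, hloc, hfin⟩ := exists_closedBall_forall hGd hα hβ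
  have hshell := setLIntegral_shell_prod_lt_top hr hloc
  have hfreq : ¬ ∀ᵐ v ∂ν.restrict (Metric.closedBall 0 r),
      ∀ᵐ u, OrdGT (fun u => G (u, v)) (d * α - γ) u := fun hord =>
    hnot ⟨_, Metric.closedBall_mem_nhds 0 hr,
      setLIntegral_closedBall_lt_top hγ hFm hF hGm hr hd hord hshell⟩
  have hmeas : Measurable fun v => ∫⁻ u in shell γ r, dens F (fun u => G (u, v)) α u :=
    (dens_measurable (hFm.comp measurable_fst) hGm α).lintegral_prod_left'
  rw [setLIntegral_prod_dens hFm hGm] at hshell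
  obtain ⟨v, hv, hordv, hfinv, hvB⟩ := ((not_eventually.1 hfreq).and_eventually
    ((ae_ae_ordGT hγ hFm hF hF0 hGm hr hd hfin).and ((ae_lt_top hmeas hshell.ne).and
    (ae_restrict_mem Metric.isClosed_closedBall.measurableSet)))).exists
  have hhm : Measurable fun u => G (u, v) := hGm.comp measurable_prodMk_right
  have hh0 := eventually_differentiableAt_slice hr hd hvB
  have hle : (γ : ℝ) ≤ d * α := by
    obtain ⟨u, hu⟩ := (not_eventually.1 hv).exists
    simp only [OrdGT, not_forall, not_lt] at hu
    obtain ⟨k, -, hk⟩ := hu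
    linarith [(Nat.cast_nonneg k : (0 : ℝ) ≤ k)]
  have hd0 : (0 : ℝ) < d := by
    rcases Nat.eq_zero_or_pos d with h0 | h0
    · rw [h0, Nat.cast_zero, zero_mul] at hle
      exact absurd hγ (by exact_mod_cast hle.not_gt)
    · exact_mod_cast h0
  refine ⟨hle, fun u => G (u, v), hhm, hh0, fun β' hβ' hβα => ?_, fun hfin' => ?_⟩
  · obtain ⟨C, hC, hCle⟩ := exists_setLIntegral_closedBall_le hγ hFm hF β'
    refine ⟨_, Metric.closedBall_mem_nhds 0 hr, (hCle _ r hhm hr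
      (fun u hu => differentiableAt_slice (hd _ (mem_closedBall_prod hu hvB))) hh0 ?_).trans_lt
      (ENNReal.mul_lt_top hC.lt_top ?_)⟩
    · filter_upwards [hordv] with u hu k hk
      have := hgap (k + γ) (by push_cast; linarith [hu k hk])
      push_cast at this
      linarith [mul_lt_mul_of_pos_left hβα hd0]
    · obtain ⟨M, hM⟩ := (isCompact_shell (γ := γ) r).exists_bound_of_continuousOn hFc.continuousOn
      refine (setLIntegral_mono' (isCompact_shell r).measurableSet fun u hu =>
        dens_le_of_le hβ' hβα.le (hM u hu)).trans_lt ?_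
      rw [lintegral_const_mul' _ _ ENNReal.ofReal_ne_top]
      exact ENNReal.mul_lt_top ENNReal.ofReal_lt_top hfinv
  · exact hv (ae_ordGT_of_locFin hγ hFm hF hF0 hhm hh0 hfin')

end Product

lemma locFin_prod_iff {γ : ℕ} {Y : Type*} [NormedAddCommGroup Y] [ProperSpace Y]
    [MeasurableSpace Y] {ν : Measure Y} [IsFiniteMeasureOnCompacts ν] [ν.IsOpenPosMeasure]
    {F : (Fin γ → ℂ) → ℂ} (hFm : Measurable F) {h : (Fin γ → ℂ) → ℂ} (hm : Measurable h) (α : ℝ) :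
    LocFin (volume.prod ν) (dens (fun p => F p.1) (fun p => h p.1) α) 0 ↔
      LocFin volume (dens F h α) 0 := by
  have key : ∀ (S : Set (Fin γ → ℂ)) (T : Set Y),
      ∫⁻ p in S ×ˢ T, dens (fun p => F p.1) (fun p => h p.1) α p ∂(volume.prod ν) =
        (∫⁻ u in S, dens F h α u) * ν T := by
    intro S T
    rw [setLIntegral_prod_dens (G := fun p => h p.1) hFm (hm.comp measurable_fst)]
    simp
  have hball : ∀ r : ℝ, Metric.closedBall (0 : (Fin γ → ℂ) × Y) r =
      Metric.closedBall 0 r ×ˢ Metric.closedBall 0 r := fun r => by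
    rw [closedBall_prod_same]; rfl
  constructor
  · rintro ⟨W, hW, hfin⟩
    obtain ⟨r, hr, hrW⟩ := Metric.nhds_basis_closedBall.mem_iff.1 hW
    refine ⟨Metric.closedBall 0 r, Metric.closedBall_mem_nhds 0 hr, ?_⟩
    have h1 := (lintegral_mono_set hrW).trans_lt hfin
    rw [hball, key] at h1
    exact lt_top_iff_ne_top.2 fun h2 => h1.ne (by
      rw [h2, ENNReal.top_mul (Metric.measure_closedBall_pos ν 0 hr).ne'])
  · rintro ⟨W, hW, hfin⟩
    refine ⟨W ×ˢ Metric.closedBall 0 1,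
      prod_mem_nhds hW (Metric.closedBall_mem_nhds 0 one_pos), ?_⟩
    rw [key]
    exact ENNReal.mul_lt_top hfin (isCompact_closedBall _ _).measure_lt_top

section Chart

variable {n γ : ℕ} {V : Submodule ℂ (Fin n → ℂ)} {ψ : (Fin γ → ℂ) →ₗ[ℂ] (Fin n → ℂ)}

/-- The linear coordinates `(u, v) ↦ ψ u + v` attached to a complement `range ψ` of `V`. -/
def splitEquiv (hψ : Function.Injective ψ) (hV : IsCompl V (LinearMap.range ψ)) :
    ((Fin γ → ℂ) × V) ≃L[ℂ] (Fin n → ℂ) :=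
  (((LinearEquiv.ofInjective ψ hψ).prodCongr (LinearEquiv.refl ℂ V)).trans
    (Submodule.prodEquivOfIsCompl _ V hV.symm)).toContinuousLinearEquiv

lemma splitEquiv_apply (hψ : Function.Injective ψ) (hV : IsCompl V (LinearMap.range ψ))
    (p : (Fin γ → ℂ) × V) : splitEquiv hψ hV p = ψ p.1 + p.2 := by
  simp [splitEquiv]

instance instProperSpaceSubmodule : ProperSpace V := FiniteDimensional.proper ℂ V

lemma tendsto_add_splitEquiv (hψ : Function.Injective ψ) (hV : IsCompl V (LinearMap.range ψ))
    (x : Fin n → ℂ) : Tendsto (fun p => x + splitEquiv hψ hV p) (𝓝 0) (𝓝 x) := by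
  have : Continuous fun p => x + splitEquiv hψ hV p := by fun_prop
  simpa using this.tendsto 0

lemma locFin_splitEquiv_iff (hψ : Function.Injective ψ) (hV : IsCompl V (LinearMap.range ψ))
    (x : Fin n → ℂ) (Φ : (Fin n → ℂ) → ℝ≥0∞) (p : (Fin γ → ℂ) × V) :
    LocFin volume Φ (x + splitEquiv hψ hV p) ↔
      LocFin (volume.prod (Measure.addHaar : Measure V))
        (fun p => Φ (x + splitEquiv hψ hV p)) p := by
  set E := splitEquiv hψ hV
  let e : ((Fin γ → ℂ) × V) ≃ₜ (Fin n → ℂ) := E.toHomeomorph.trans (Homeomorph.addLeft x)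
  let μ : Measure ((Fin γ → ℂ) × V) := volume.prod Measure.addHaar
  have : μ.IsAddHaarMeasure := Measure.prod.instIsAddHaarMeasure _ _
  have h1 : (μ.map E).IsAddHaarMeasure := E.isAddHaarMeasure_map μ
  have h2 : μ.map e = μ.map E := by
    have : (e : (Fin γ → ℂ) × V → Fin n → ℂ) = (fun y => x + y) ∘ E := rfl
    rw [this, ← Measure.map_map (measurable_const_add x) E.continuous.measurable,
      map_add_left_eq_self]
  have h3 := Measure.isAddLeftInvariant_eq_smul (μ.map E) (volume : Measure (Fin n → ℂ))
  exact locFin_homeomorph_iff (μ := μ) e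
    (c := (Measure.addHaarScalarFactor (μ.map E) volume : ℝ≥0∞))
    (ENNReal.coe_ne_zero.2 (Measure.addHaarScalarFactor_pos_of_isAddHaarMeasure _ _).ne')
    ENNReal.coe_ne_top (h2.trans h3) Φ p

end Chart

lemma exists_transversal {n γ : ℕ} (V : Submodule ℂ (Fin n → ℂ))
    (hγ : γ = n - Module.finrank ℂ V) :
    ∃ ψ : (Fin γ → ℂ) →ₗ[ℂ] (Fin n → ℂ), Function.Injective ψ ∧
      IsCompl V (LinearMap.range ψ) := by
  obtain ⟨C, hC⟩ := V.exists_isCompl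
  have h := Submodule.finrank_add_eq_of_isCompl hC
  rw [Module.finrank_fin_fun] at h
  let e : (Fin γ → ℂ) ≃ₗ[ℂ] C := LinearEquiv.ofFinrankEq _ _ (by
    rw [Module.finrank_fin_fun]; omega)
  refine ⟨C.subtype ∘ₗ e.toLinearMap, C.injective_subtype.comp e.injective, ?_⟩
  rwa [LinearMap.range_comp, LinearEquiv.range, Submodule.map_top, Submodule.range_subtype]

/-- A proper complex subspace is a null set. -/
lemma addHaar_complexSubmodule {E : Type*} [NormedAddCommGroup E] [NormedSpace ℂ E]
    [FiniteDimensional ℂ E] [MeasurableSpace E] [BorelSpace E] (μ : Measure E)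
    [μ.IsAddHaarMeasure] {W : Submodule ℂ E} (hW : W ≠ ⊤) : μ W = 0 := by
  have : FiniteDimensional ℝ E := FiniteDimensional.complexToReal E
  exact Measure.addHaar_submodule μ (W.restrictScalars ℝ) fun h =>
    hW ((Submodule.restrictScalars_eq_top_iff ℝ ℂ E).1 h)

lemma ae_ne_zero_of_linearMap {E : Type*} [NormedAddCommGroup E] [NormedSpace ℂ E]
    [FiniteDimensional ℂ E] [MeasurableSpace E] [BorelSpace E] (μ : Measure E)
    [μ.IsAddHaarMeasure] {l : E →ₗ[ℂ] ℂ} (hl : l ≠ 0) : ∀ᵐ y ∂μ, l y ≠ 0 := by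
  have h := addHaar_complexSubmodule μ (W := LinearMap.ker l) (mt LinearMap.ker_eq_top.1 hl)
  rw [ae_iff]
  convert h using 2
  ext
  simp

namespace Arrangement

variable {n γ : ℕ} (D : Arrangement n) (V : Submodule ℂ (Fin n → ℂ))

/-- The defining polynomial of the arrangement induced on a complement of `V`. -/
def transversal (ψ : (Fin γ → ℂ) →ₗ[ℂ] (Fin n → ℂ)) (u : Fin γ → ℂ) : ℂ :=
  ∏ i ∈ Finset.univ.filter fun i => V ≤ LinearMap.ker (D.g i), D.g i (ψ u) ^ D.m i

lemma continuous_g (i : D.ι) : Continuous (D.g i) := LinearMap.continuous_of_finiteDimensional _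

lemma continuous_f : Continuous D.f :=
  continuous_finsetProd _ fun i _ => (D.continuous_g i).pow _

lemma continuous_transversal (ψ : (Fin γ → ℂ) →ₗ[ℂ] (Fin n → ℂ)) :
    Continuous (D.transversal V ψ) :=
  continuous_finsetProd _ fun i _ =>
    ((D.continuous_g i).comp (LinearMap.continuous_of_finiteDimensional ψ)).pow _

lemma transversal_smul (ψ : (Fin γ → ℂ) →ₗ[ℂ] (Fin n → ℂ)) (c : ℂ) (u : Fin γ → ℂ) :
    D.transversal V ψ (c • u) = c ^ D.mu V * D.transversal V ψ u := by
  simp only [transversal, mu, map_smul, smul_eq_mul, mul_pow, Finset.prod_mul_distrib,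
    Finset.prod_pow_eq_pow_sum]

variable {V} {ψ : (Fin γ → ℂ) →ₗ[ℂ] (Fin n → ℂ)}

lemma ae_transversal_ne_zero (hV : IsCompl V (LinearMap.range ψ)) :
    ∀ᵐ u, D.transversal V ψ u ≠ 0 := by
  have h : ∀ i ∈ Finset.univ.filter fun i => V ≤ LinearMap.ker (D.g i),
      ∀ᵐ u : Fin γ → ℂ, (D.g i ∘ₗ ψ) u ≠ 0 := fun i hi =>
    ae_ne_zero_of_linearMap volume fun h0 => D.g_ne i <| LinearMap.ker_eq_top.1 <| top_le_iff.1 <|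
      hV.sup_eq_top ▸ sup_le (Finset.mem_filter.1 hi).2 (LinearMap.range_le_ker_iff.2 h0)
  filter_upwards [(Finset.eventually_all _).2 h] with u hu
  exact Finset.prod_ne_zero_iff.2 fun i hi => pow_ne_zero _ (hu i hi)

lemma f_add_splitEquiv (hψ : Function.Injective ψ) (hV : IsCompl V (LinearMap.range ψ))
    {x : Fin n → ℂ} (hx : x ∈ V) (p : (Fin γ → ℂ) × V) :
    D.f (x + splitEquiv hψ hV p) = D.transversal V ψ p.1 *
      ∏ i ∈ Finset.univ.filter fun i => ¬ V ≤ LinearMap.ker (D.g i),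
        D.g i (x + splitEquiv hψ hV p) ^ D.m i := by
  rw [f, transversal, ← Finset.prod_filter_mul_prod_filter_not Finset.univ
    fun i => V ≤ LinearMap.ker (D.g i)]
  congr 1
  refine Finset.prod_congr rfl fun i hi => ?_
  have hi := (Finset.mem_filter.1 hi).2
  rw [splitEquiv_apply, map_add, map_add, LinearMap.mem_ker.1 (hi hx),
    LinearMap.mem_ker.1 (hi p.2.2), zero_add, add_zero]

/-- Near a generic point of `V` the arrangement is the product of `V` with the arrangement
induced on a complement of `V`. -/
lemma locFin_transversal_iff (hψ : Function.Injective ψ) (hV : IsCompl V (LinearMap.range ψ))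
    {x : Fin n → ℂ} (hx : x ∈ V) (hxV : ∀ i, D.g i x = 0 → V ≤ LinearMap.ker (D.g i)) :
    ∀ᶠ p in 𝓝 (0 : (Fin γ → ℂ) × V), ∀ (g : (Fin n → ℂ) → ℂ) (β : ℝ),
      LocFin volume (dens D.f g β) (x + splitEquiv hψ hV p) ↔
        LocFin (volume.prod (Measure.addHaar : Measure V))
          (dens (fun p => D.transversal V ψ p.1) (fun p => g (x + splitEquiv hψ hV p)) β) p := by
  let c : (Fin n → ℂ) → ℂ := fun y =>
    ∏ i ∈ Finset.univ.filter fun i => ¬ V ≤ LinearMap.ker (D.g i), D.g i y ^ D.m i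
  have hc : Continuous c := continuous_finsetProd _ fun i _ => (D.continuous_g i).pow _
  have hcx : c x ≠ 0 := Finset.prod_ne_zero_iff.2 fun i hi =>
    pow_ne_zero _ (mt (hxV i) (Finset.mem_filter.1 hi).2)
  filter_upwards [(tendsto_add_splitEquiv hψ hV x).eventually (hc.continuousAt.eventually_ne hcx)]
    with p hp g β
  rw [locFin_splitEquiv_iff, ← locFin_dens_mul_unit_iff (c := fun p => c (x + splitEquiv hψ hV p))
    (by fun_prop) hp]
  refine iff_of_eq (congrArg (LocFin _ · p) (funext fun q => ?_))
  simp only [dens, D.f_add_splitEquiv hψ hV hx, c]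

end Arrangement

lemma locFin_dens_of_ne_zero {n : ℕ} {f g : (Fin n → ℂ) → ℂ} {x : Fin n → ℂ}
    (hf : ContinuousAt f x) (hfx : f x ≠ 0) (hg : ContinuousAt g x) (β : ℝ) :
    LocFin volume (dens f g β) x := by
  refine locFin_of_continuousAt ?_ ?_
  · refine ENNReal.Tendsto.mul (ENNReal.Tendsto.pow hg.enorm) (.inr ENNReal.ofReal_ne_top)
      (ENNReal.tendsto_ofReal (hf.norm.rpow_const (.inl (by simpa using hfx)))) (.inr ?_)
    simp
  · simp [dens, ENNReal.mul_eq_top]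

/-- Below `α` there is an exponent past which no `k / d` with `d ≤ D` is met before `α`. -/
lemma exists_lt_forall_mul_le (D : ℕ) {α : ℝ} (h0 : 0 < α) :
    ∃ β : ℝ, 0 < β ∧ β < α ∧ ∀ d ≤ D, ∀ N : ℕ, d * β < N → d * α ≤ N := by
  have h : ∀ d ∈ Finset.range (D + 1), ∀ᶠ β : ℝ in 𝓝[<] α, ∀ N : ℕ, d * β < N → d * α ≤ N := by
    intro d _
    rcases Nat.eq_zero_or_pos d with rfl | hd
    · exact .of_forall fun β N _ => by simp
    have hd' : (0 : ℝ) < d := by exact_mod_cast hd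
    have hlt : (⌈d * α⌉₊ - 1 : ℝ) < d * α := by
      linarith [Nat.ceil_lt_add_one (mul_pos hd' h0).le]
    have ht : Tendsto (fun β : ℝ => d * β) (𝓝[<] α) (𝓝 (d * α)) :=
      ((continuous_const.mul continuous_id).tendsto α).mono_left nhdsWithin_le_nhds
    filter_upwards [ht.eventually (lt_mem_nhds hlt)] with β hβ N hN
    have : (⌈d * α⌉₊ : ℝ) < (N + 1 : ℕ) := by push_cast; linarith
    exact Nat.ceil_le.1 (Nat.lt_succ_iff.1 (by exact_mod_cast this))
  have hpos : ∀ᶠ β : ℝ in 𝓝[<] α, 0 < β := mem_nhdsWithin_of_mem_nhds (lt_mem_nhds h0)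
  obtain ⟨β, hβ, hβ0, hβα⟩ := (((Finset.eventually_all _).2 h).and
    (hpos.and eventually_mem_nhdsWithin)).exists
  exact ⟨β, hβ0, hβα, fun d hd => hβ d (Finset.mem_range.2 (by omega))⟩

namespace Arrangement

variable {n γ : ℕ} (D : Arrangement n) (x : Fin n → ℂ)

/-- The indices of the hyperplanes through `x`. -/
def vanishing : Finset D.ι := Finset.univ.filter fun i => D.g i x = 0

/-- The smallest edge containing `x`. -/
def stratum : Submodule ℂ (Fin n → ℂ) := ⨅ i ∈ {i | D.g i x = 0}, LinearMap.ker (D.g i)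

lemma mem_stratum {y : Fin n → ℂ} : y ∈ D.stratum x ↔ ∀ i, D.g i x = 0 → D.g i y = 0 := by
  simp [stratum, Submodule.mem_iInf]

lemma self_mem_stratum : x ∈ D.stratum x := (D.mem_stratum x).2 fun _ => id

lemma stratum_le_ker {i : D.ι} (h : D.g i x = 0) : D.stratum x ≤ LinearMap.ker (D.g i) :=
  iInf₂_le i h

variable {x}

lemma exists_g_eq_zero (hx : D.f x = 0) : ∃ i, D.g i x = 0 := by
  obtain ⟨i, -, hi⟩ := Finset.prod_eq_zero_iff.1 hx
  exact ⟨i, pow_eq_zero_iff (D.m_pos i).ne' |>.1 hi⟩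

lemma stratum_mem_edges (hx : D.f x = 0) : D.stratum x ∈ D.edges :=
  ⟨_, D.exists_g_eq_zero hx, rfl⟩

lemma gamma_stratum_pos (hx : D.f x = 0) : 0 < D.gamma (D.stratum x) := by
  obtain ⟨i, hi⟩ := D.exists_g_eq_zero hx
  have h := Submodule.finrank_lt (s := D.stratum x) fun h =>
    D.g_ne i (LinearMap.ker_eq_top.1 (top_le_iff.1 (h ▸ D.stratum_le_ker x hi)))
  rw [Module.finrank_fin_fun] at h
  exact Nat.sub_pos_of_lt h

lemma mu_le_degree (V : Submodule ℂ (Fin n → ℂ)) : D.mu V ≤ D.degree :=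
  Finset.sum_le_sum_of_subset (Finset.filter_subset _ _)

lemma eventually_vanishing_ssubset {ψ : (Fin γ → ℂ) →ₗ[ℂ] (Fin n → ℂ)}
    (hψ : Function.Injective ψ) (hV : IsCompl (D.stratum x) (LinearMap.range ψ)) :
    ∀ᶠ p in 𝓝 0, p.1 ≠ 0 → D.vanishing (x + splitEquiv hψ hV p) ⊂ D.vanishing x := by
  have h : ∀ i ∈ (D.vanishing x)ᶜ, ∀ᶠ y in 𝓝 x, D.g i y ≠ 0 := fun i hi =>
    (D.continuous_g i).continuousAt.eventually_ne (by simpa [vanishing] using hi)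
  filter_upwards [(tendsto_add_splitEquiv hψ hV x).eventually ((Finset.eventually_all _).2 h)]
    with p hp hp0
  refine Finset.ssubset_iff_subset_ne.2 ⟨fun i hi => ?_, fun heq => hp0 ?_⟩
  · by_contra hix
    exact hp i (Finset.mem_compl.2 hix) (Finset.mem_filter.1 hi).2
  · have hmem : ψ p.1 ∈ D.stratum x := (D.mem_stratum x).2 fun i hi => by
      have h1 : i ∈ D.vanishing (x + splitEquiv hψ hV p) := by
        rw [heq]; simpa [vanishing] using hi
      have h2 := (Finset.mem_filter.1 h1).2
      rwa [splitEquiv_apply, map_add, map_add, hi, (D.mem_stratum x).1 p.2.2 i hi, zero_add,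
        add_zero] at h2
    exact hψ (by rw [Submodule.disjoint_def.1 hV.disjoint _ hmem ⟨_, rfl⟩, map_zero])

lemma eventually_differentiableAt_comp_splitEquiv {V : Submodule ℂ (Fin n → ℂ)}
    {ψ : (Fin γ → ℂ) →ₗ[ℂ] (Fin n → ℂ)} (hψ : Function.Injective ψ)
    (hV : IsCompl V (LinearMap.range ψ)) {g : (Fin n → ℂ) → ℂ}
    (hd : ∀ᶠ y in 𝓝 x, DifferentiableAt ℂ g y) :
    ∀ᶠ p in 𝓝 0, DifferentiableAt ℂ (fun p => g (x + splitEquiv hψ hV p)) p := by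
  filter_upwards [(tendsto_add_splitEquiv hψ hV x).eventually hd] with p hp
  exact DifferentiableAt.comp (g := g) p hp (by fun_prop)

/-- Local finiteness propagates from `β` to `α` if no candidate exponent lies in between. -/
lemma locFin_of_gap {β α : ℝ} (hgap : ∀ d ≤ D.degree, ∀ N : ℕ, d * β < N → d * α < N)
    {g : (Fin n → ℂ) → ℂ} (hg : Measurable g) (hd : ∀ᶠ y in 𝓝 x, DifferentiableAt ℂ g y)
    (hβ : LocFin volume (dens D.f g β) x) : LocFin volume (dens D.f g α) x := by
  induction hk : (D.vanishing x).card using Nat.strong_induction_on generalizing x with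
  | _ k ih =>
  by_cases hx : D.f x = 0
  swap
  · exact locFin_dens_of_ne_zero D.continuous_f.continuousAt hx hd.self_of_nhds.continuousAt α
  obtain ⟨ψ, hψ, hV⟩ := exists_transversal (D.stratum x) (γ := D.gamma (D.stratum x)) rfl
  have hT := tendsto_add_splitEquiv hψ hV x
  have hiff := D.locFin_transversal_iff hψ hV (D.self_mem_stratum x) fun i => D.stratum_le_ker x
  have h0 := hiff.self_of_nhds g
  simp only [map_zero, add_zero] at h0
  rw [h0] at hβ ⊢
  refine _root_.locFin_of_gap (D.gamma_stratum_pos hx) (D.continuous_transversal _ ψ).measurable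
    (D.transversal_smul _ ψ) (D.ae_transversal_ne_zero hV) (hg.comp (by fun_prop))
    (eventually_differentiableAt_comp_splitEquiv hψ hV hd)
    (hgap _ (D.mu_le_degree _)) hβ ?_
  filter_upwards [hiff, D.eventually_vanishing_ssubset hψ hV, hT.eventually hd.eventually_nhds,
    hT.eventually ((h0 β).2 hβ).eventually] with p hp hlt hdp hβp hp0
  exact (hp g α).1 (ih _ (hk ▸ Finset.card_lt_card (hlt hp0)) hdp hβp rfl)

/-- A jumping coefficient in `(0, 1)` is realized on a complement of an edge. -/
lemma exists_edge_of_mem_JC {α : ℝ} (h1 : α < 1) (hα : α ∈ D.JC) :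
    ∃ V ∈ D.edges, D.gamma V < D.mu V ∧
      ∃ ψ : (Fin (D.gamma V) → ℂ) →ₗ[ℂ] (Fin n → ℂ),
        Function.Injective ψ ∧ IsCompl V (LinearMap.range ψ) ∧
        JumpingAtOf (D.transversal V ψ) α 0 := by
  obtain ⟨h0, hex⟩ := hα
  obtain ⟨x, hjump, hmin⟩ := exists_minimalFor_of_wellFoundedLT (fun x => JumpingAtOf D.f α x)
    (fun x => (D.vanishing x).card) hex
  obtain ⟨g, hg, hd, hlt, hnot⟩ := (jumpingAtOf_iff D.continuous_f.measurable).1 hjump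
  have hx : D.f x = 0 := by
    by_contra hx
    exact hnot (locFin_dens_of_ne_zero D.continuous_f.continuousAt hx
      hd.self_of_nhds.continuousAt α)
  obtain ⟨β, hβ0, hβα, hβ⟩ := exists_lt_forall_mul_le D.degree h0
  have hnear : ∀ᶠ y in 𝓝 x, (D.vanishing y).card < (D.vanishing x).card →
      LocFin volume (dens D.f g α) y := by
    filter_upwards [hd.eventually_nhds, (hlt β hβ0 hβα).eventually] with y hdy hβy hlty
    by_contra hny
    refine (hmin ((jumpingAtOf_iff D.continuous_f.measurable).2 ⟨g, hg, hdy, ?_, hny⟩)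
      hlty.le).not_gt hlty
    intro β' hβ' hβ'α
    rcases le_or_gt β' β with h | h
    · exact hβy.anti_exponent D.continuous_f.continuousAt hβ' h
    · refine D.locFin_of_gap (fun d hd N hN => ?_) hg hdy hβy
      have hNα := hβ d hd N hN
      rcases Nat.eq_zero_or_pos d with rfl | hd0
      · simpa using hN
      · exact (mul_lt_mul_of_pos_left hβ'α (by exact_mod_cast hd0)).trans_le hNα
  have hγ := D.gamma_stratum_pos hx
  obtain ⟨ψ, hψ, hV⟩ := exists_transversal (D.stratum x) (γ := D.gamma (D.stratum x)) rfl
  have hT := tendsto_add_splitEquiv hψ hV x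
  have hiff := D.locFin_transversal_iff hψ hV (D.self_mem_stratum x) fun i => D.stratum_le_ker x
  have hx0 := hiff.self_of_nhds g
  simp only [map_zero, add_zero] at hx0
  have hoff : ∀ᶠ p in 𝓝 0, p.1 ≠ 0 → LocFin (volume.prod Measure.addHaar)
      (dens (fun p => D.transversal (D.stratum x) ψ p.1)
        (fun p => g (x + splitEquiv hψ hV p)) α) p := by
    filter_upwards [hiff, D.eventually_vanishing_ssubset hψ hV, hT.eventually hnear]
      with p hp hss hnp hp0
    exact (hp g α).1 (hnp (Finset.card_lt_card (hss hp0)))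
  obtain ⟨hle, h⟩ := exists_slice_of_not_locFin hγ (D.continuous_transversal _ ψ)
    (D.transversal_smul _ ψ) (D.ae_transversal_ne_zero hV) (hg.comp (by fun_prop))
    (eventually_differentiableAt_comp_splitEquiv hψ hV hd)
    (hβ _ (D.mu_le_degree _)) ((hx0 β).1 (hlt β hβ0 hβα)) hoff (mt (hx0 α).2 hnot)
  refine ⟨_, D.stratum_mem_edges hx, ?_, ψ, hψ, hV,
    (jumpingAtOf_iff (D.continuous_transversal _ ψ).measurable).2 h⟩
  have hγ' : (0 : ℝ) < D.gamma (D.stratum x) := by exact_mod_cast hγ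
  have : (D.gamma (D.stratum x) : ℝ) < D.mu (D.stratum x) := by
    by_contra! hc
    nlinarith [(Nat.cast_nonneg (D.mu (D.stratum x)) : (0 : ℝ) ≤ _)]
  exact_mod_cast this

lemma exists_generic_point (V : Submodule ℂ (Fin n → ℂ)) :
    ∃ x ∈ V, ∀ i, D.g i x = 0 → V ≤ LinearMap.ker (D.g i) := by
  have h : ∀ i, ∀ᵐ v : V ∂Measure.addHaar, D.g i v = 0 → V ≤ LinearMap.ker (D.g i) := by
    intro i
    by_cases hi : V ≤ LinearMap.ker (D.g i)
    · exact .of_forall fun _ _ => hi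
    · have hne : (D.g i).domRestrict V ≠ 0 := fun h => hi fun v hv =>
        LinearMap.congr_fun h ⟨v, hv⟩
      filter_upwards [ae_ne_zero_of_linearMap Measure.addHaar hne] with v hv hv0
      exact absurd hv0 hv
  obtain ⟨v, hv⟩ := (ae_all_iff.2 h).exists
  exact ⟨v, v.2, hv⟩

/-- A jumping coefficient of the arrangement induced on a complement of a subspace is a jumping
coefficient of the arrangement. -/
lemma exists_jumpingAtOf_of_transversal {V : Submodule ℂ (Fin n → ℂ)}
    {ψ : (Fin γ → ℂ) →ₗ[ℂ] (Fin n → ℂ)} (hψ : Function.Injective ψ)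
    (hV : IsCompl V (LinearMap.range ψ)) {α : ℝ} (h : JumpingAtOf (D.transversal V ψ) α 0) :
    ∃ x, JumpingAtOf D.f α x := by
  obtain ⟨x, hxV, hx⟩ := D.exists_generic_point V
  have hFm := (D.continuous_transversal V ψ).measurable
  obtain ⟨h, hm, hd, hlt, hnot⟩ := (jumpingAtOf_iff hFm).1 h
  let π : (Fin n → ℂ) → (Fin γ → ℂ) := fun y => ((splitEquiv hψ hV).symm (y - x)).1
  have hπc : Continuous π := by fun_prop
  have hiff : ∀ β, LocFin volume (dens D.f (h ∘ π) β) x ↔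
      LocFin volume (dens (D.transversal V ψ) h β) 0 := fun β => by
    have := (D.locFin_transversal_iff hψ hV hxV hx).self_of_nhds (h ∘ π) β
    simp only [map_zero, add_zero, Function.comp_apply, π, add_sub_cancel_left,
      ContinuousLinearEquiv.symm_apply_apply] at this
    exact this.trans (locFin_prod_iff hFm hm β)
  refine ⟨x, (jumpingAtOf_iff D.continuous_f.measurable).2 ⟨h ∘ π, hm.comp hπc.measurable, ?_,
    fun β h0 hβ => (hiff β).2 (hlt β h0 hβ), mt (hiff α).1 hnot⟩⟩
  have hπx : Tendsto π (𝓝 x) (𝓝 0) := by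
    simpa [π] using hπc.tendsto x
  filter_upwards [hπx.eventually hd] with y hy
  exact DifferentiableAt.comp y hy (by fun_prop)

end Arrangement

/-- **Proposition 1 (jumping-coefficient form).** For `α ∈ (0,1)`, `α ∈ JC(D)` iff `α` is a
jumping coefficient at `0` of the restricted arrangement `D_V` on a linear complement of
some edge `V` contained in the non-reduced-normal-crossing locus, i.e. with
`μ(V) > γ(V)`. -/
theorem jc_localizes_to_edges {n : ℕ} (D : Arrangement n) (hess : D.Essential)
    (hnc : n < D.degree) (α : ℝ) (h0 : 0 < α) (h1 : α < 1) :
    α ∈ D.JC ↔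
      ∃ V ∈ D.edges, D.gamma V < D.mu V ∧
        ∃ ψ : (Fin (D.gamma V) → ℂ) →ₗ[ℂ] (Fin n → ℂ),
          Function.Injective ψ ∧ IsCompl V (LinearMap.range ψ) ∧
          JumpingAtOf
            (fun y => ∏ i ∈ Finset.univ.filter fun i => V ≤ LinearMap.ker (D.g i),
              D.g i (ψ y) ^ D.m i) α 0 := by
  constructor
  · exact D.exists_edge_of_mem_JC h1
  · rintro ⟨V, -, -, ψ, hψ, hV, h⟩
    exact ⟨h0, D.exists_jumpingAtOf_of_transversal hψ hV h⟩
end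
end

section
/- Let D be a central essential hyperplane arrangement in ℂ^n (multiplicities allowed) of degree d > n. If α ∈ JC(D) and 0 < α < 1, then there exists an edge V ∈ S(D) with μ(V) > γ(V) such that α·μ(V) ∈ ℤ. In particular every jumping coefficient of D in (0,1) is a rational number whose denominator divides the multiplicity μ(V) of some edge V along which D is not a reduced normal crossing divisor. (Consequence of Proposition 1 together with the fact that the spectrum of a central arrangement of degree d' is supported in (1/d')·ℤ.) -/
open MeasureTheory
open scoped Classical

noncomputable section

open Filter Topology Asymptotics Metric in
/-- A bounded holomorphic function on the unit disc which is `O(z ^ k)` at the origin is `z ^ k`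
times a holomorphic function with the same bound. -/
theorem exists_eq_pow_mul_of_isBigO {φ : ℂ → ℂ} {M : ℝ} {k : ℕ}
    (hd : DifferentiableOn ℂ φ (ball 0 1)) (hM : ∀ z ∈ ball (0 : ℂ) 1, ‖φ z‖ ≤ M)
    (hO : φ =O[𝓝 0] fun z => z ^ k) :
    ∃ ψ : ℂ → ℂ, DifferentiableOn ℂ ψ (ball 0 1) ∧ (∀ z, φ z = z ^ k * ψ z) ∧
      ∀ z ∈ ball (0 : ℂ) 1, ‖ψ z‖ ≤ M := by
  have h01 : (0 : ℂ) ∈ ball (0 : ℂ) 1 := mem_ball_self one_pos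
  have hn : ball (0 : ℂ) 1 ∈ 𝓝 (0 : ℂ) := isOpen_ball.mem_nhds h01
  induction k generalizing φ with
  | zero => exact ⟨φ, hd, by simp, hM⟩
  | succ k ih =>
    have h0 : φ 0 = 0 := by
      obtain ⟨C, hC⟩ := hO.bound
      simpa using hC.self_of_nhds
    have hz : ∀ z, φ z = z * dslope φ 0 z := by
      intro z
      have := sub_smul_dslope φ 0 z
      simpa [h0] using this.symm
    have hmaps : Set.MapsTo φ (ball 0 1) (closedBall (φ 0) M) := by
      intro z hz'
      simpa [h0] using hM z hz'
    have hM' : ∀ z ∈ ball (0 : ℂ) 1, ‖dslope φ 0 z‖ ≤ M := by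
      intro z hz'
      rcases eq_or_ne z 0 with rfl | hne
      · simpa using Complex.norm_deriv_le_div_of_mapsTo_ball hd hmaps one_pos
      · have h := Complex.dist_le_div_mul_dist_of_mapsTo_ball hd hmaps hz'
        rw [h0, dist_zero_right, dist_zero_right, div_one, hz z, norm_mul, mul_comm] at h
        exact le_of_mul_le_mul_right h (norm_pos_iff.2 hne)
    have hd' : DifferentiableOn ℂ (dslope φ 0) (ball 0 1) :=
      (Complex.differentiableOn_dslope hn).2 hd
    have hO' : dslope φ 0 =O[𝓝 0] fun z => z ^ k := by
      obtain ⟨C, hC⟩ := hO.bound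
      have hle : ∀ᶠ z in 𝓝[≠] (0 : ℂ), ‖dslope φ 0 z‖ ≤ C * ‖z‖ ^ k := by
        filter_upwards [hC.filter_mono nhdsWithin_le_nhds, self_mem_nhdsWithin] with z h1 hne
        rw [hz z, norm_mul, norm_pow, pow_succ', mul_left_comm] at h1
        exact le_of_mul_le_mul_left h1 (norm_pos_iff.2 hne)
      have hc : ContinuousAt (dslope φ 0) 0 := (hd'.differentiableAt hn).continuousAt
      have h00 : ‖dslope φ 0 0‖ ≤ C * ‖(0 : ℂ)‖ ^ k := by
        refine le_of_tendsto_of_tendsto (hc.norm.tendsto.mono_left nhdsWithin_le_nhds)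
          (Tendsto.mono_left (f := fun z : ℂ => C * ‖z‖ ^ k) ?_ nhdsWithin_le_nhds) hle
        exact Continuous.tendsto (by fun_prop) 0
      refine IsBigO.of_bound C ?_
      rw [eventually_nhdsWithin_iff] at hle
      filter_upwards [hle] with z h
      rcases eq_or_ne z 0 with rfl | hne
      · simpa using h00
      · simpa using h hne
    obtain ⟨ψ, h1, h2, h3⟩ := ih hd' hM' hO'
    refine ⟨ψ, h1, fun z => ?_, h3⟩
    rw [hz z, h2 z]; ring

open Filter Topology Asymptotics Metric in
/-- Higher order Schwarz lemma. -/
theorem norm_le_mul_pow_of_isBigO {φ : ℂ → ℂ} {M : ℝ} {k : ℕ}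
    (hd : DifferentiableOn ℂ φ (ball 0 1)) (hM : ∀ z ∈ ball (0 : ℂ) 1, ‖φ z‖ ≤ M)
    (hO : φ =O[𝓝 0] fun z => z ^ k) {z : ℂ} (hz : z ∈ ball (0 : ℂ) 1) :
    ‖φ z‖ ≤ M * ‖z‖ ^ k := by
  obtain ⟨ψ, -, h2, h3⟩ := exists_eq_pow_mul_of_isBigO hd hM hO
  rw [h2, norm_mul, norm_pow, mul_comm]
  gcongr
  exact h3 z hz

open Filter Topology Asymptotics Metric in
/-- Improved Schwarz lemma when the leading coefficient vanishes, as detected along the positive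
real axis. -/
theorem norm_le_mul_pow_succ_of_tendsto {φ : ℂ → ℂ} {M : ℝ} {k : ℕ}
    (hd : DifferentiableOn ℂ φ (ball 0 1)) (hM : ∀ z ∈ ball (0 : ℂ) 1, ‖φ z‖ ≤ M)
    (hO : φ =O[𝓝 0] fun z => z ^ k)
    (ht : Tendsto (fun s : ℝ => ‖φ s‖ / s ^ k) (𝓝[>] 0) (𝓝 0)) {z : ℂ}
    (hz : z ∈ ball (0 : ℂ) 1) :
    ‖φ z‖ ≤ M * ‖z‖ ^ (k + 1) := by
  obtain ⟨ψ, h1, h2, h3⟩ := exists_eq_pow_mul_of_isBigO hd hM hO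
  have hn : ball (0 : ℂ) 1 ∈ 𝓝 (0 : ℂ) := isOpen_ball.mem_nhds (mem_ball_self one_pos)
  have hψ : ψ 0 = 0 := by
    have hc : ContinuousAt (fun s : ℝ => ‖ψ s‖) 0 := by
      have : ContinuousAt ψ ((0 : ℝ) : ℂ) := by
        simpa using (h1.differentiableAt hn).continuousAt
      exact (this.comp (f := fun s : ℝ => (s : ℂ)) Complex.continuous_ofReal.continuousAt).norm
    have hl := hc.tendsto.mono_left (nhdsWithin_le_nhds (s := Set.Ioi (0 : ℝ)))
    have he : (fun s : ℝ => ‖φ s‖ / s ^ k) =ᶠ[𝓝[>] 0] fun s : ℝ => ‖ψ s‖ := by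
      filter_upwards [self_mem_nhdsWithin] with s hs
      have hs : 0 < s := hs
      rw [h2, norm_mul, norm_pow, Complex.norm_real, Real.norm_of_nonneg hs.le]
      field_simp
    simpa using tendsto_nhds_unique hl (ht.congr' he)
  refine norm_le_mul_pow_of_isBigO hd hM ?_ hz
  have hψO : ψ =O[𝓝 0] fun z => z := by
    simpa [hψ] using (h1.differentiableAt hn).isBigO_sub
  have : φ = fun z => z ^ k * ψ z := funext h2
  rw [this]
  simpa [pow_succ] using (isBigO_refl (fun z : ℂ => z ^ k) (𝓝 0)).mul hψO

/-- Contraction towards `P`: for a projection `P` this is the identity on the range of `P` and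
multiplication by `c` on the kernel of `P`. -/
def contraction {n : ℕ} (P : (Fin n → ℂ) →ₗ[ℂ] (Fin n → ℂ)) (c : ℂ) :
    (Fin n → ℂ) →ₗ[ℂ] (Fin n → ℂ) :=
  P + c • (LinearMap.id - P)

theorem contraction_apply {n : ℕ} (P : (Fin n → ℂ) →ₗ[ℂ] (Fin n → ℂ)) (c : ℂ) (y : Fin n → ℂ) :
    contraction P c y = P y + c • (y - P y) := by
  simp [contraction]

/-- Every subspace is the image of a projection whose contractions have the expected
determinant. -/
theorem exists_proj {n : ℕ} (V : Submodule ℂ (Fin n → ℂ)) :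
    ∃ P : (Fin n → ℂ) →ₗ[ℂ] (Fin n → ℂ), (∀ y, P y ∈ V) ∧ (∀ v ∈ V, P v = v) ∧
      ∀ c : ℂ, LinearMap.det (contraction P c) = c ^ (n - Module.finrank ℂ V) := by
  obtain ⟨T, hT⟩ := V.exists_isCompl
  have hdim : Module.finrank ℂ T = n - Module.finrank ℂ V := by
    have := Submodule.finrank_add_eq_of_isCompl hT
    rw [Module.finrank_fin_fun] at this
    omega
  let e := Submodule.prodEquivOfIsCompl V T hT
  let P : (Fin n → ℂ) →ₗ[ℂ] (Fin n → ℂ) :=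
    e.toLinearMap ∘ₗ (LinearMap.prodMap LinearMap.id 0) ∘ₗ e.symm.toLinearMap
  have hP : ∀ w : V × T, P (e w) = w.1 := by
    intro w; simp [P, e]
  refine ⟨P, fun y => ?_, fun v hv => ?_, fun c => ?_⟩
  · obtain ⟨w, rfl⟩ := e.surjective y
    rw [hP]; exact w.1.2
  · have : e (⟨v, hv⟩, 0) = v := by simp [e]
    conv_lhs => rw [← this, hP]
  · have : contraction P c = e.toLinearMap ∘ₗ
        (LinearMap.prodMap LinearMap.id (c • LinearMap.id)) ∘ₗ e.symm.toLinearMap := by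
      refine LinearMap.ext fun y => ?_
      obtain ⟨w, rfl⟩ := e.surjective y
      have hsub : e w - (w.1 : Fin n → ℂ) = w.2 := by simp [e]
      rw [contraction_apply, hP, hsub]
      simp [e]
    rw [this, LinearMap.det_conj, LinearMap.det_prodMap, LinearMap.det_smul]
    simp [hdim]

theorem contraction_contraction {n : ℕ} {P : (Fin n → ℂ) →ₗ[ℂ] (Fin n → ℂ)}
    (hP : ∀ y, P (P y) = P y) (a b : ℂ) (y : Fin n → ℂ) :
    contraction P a (contraction P b y) = contraction P (a * b) y := by
  simp only [contraction_apply, map_add, map_smul, map_sub, hP]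
  module

/-- Change of variables for a contraction. -/
theorem setLIntegral_contraction {n γ : ℕ} {P : (Fin n → ℂ) →ₗ[ℂ] (Fin n → ℂ)}
    (hP : ∀ y, P (P y) = P y) (hdet : ∀ c : ℂ, LinearMap.det (contraction P c) = c ^ γ)
    {s : ℝ} (hs : 0 < s) (A : Set (Fin n → ℂ))
    (F : (Fin n → ℂ) → ENNReal) :
    ∫⁻ x in (contraction P ((s : ℂ)⁻¹)) ⁻¹' A, F x =
      ENNReal.ofReal (s ^ (2 * γ)) * ∫⁻ x in A, F (contraction P s x) := by
  have hs' : (s : ℂ) ≠ 0 := by exact_mod_cast hs.ne'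
  have hid : ∀ y, contraction P 1 y = y := by intro y; simp [contraction_apply]
  let S := contraction P (s : ℂ)⁻¹
  have hcont : ∀ L : (Fin n → ℂ) →ₗ[ℂ] (Fin n → ℂ), Continuous L :=
    fun L => L.continuous_of_finiteDimensional
  let e : (Fin n → ℂ) ≃ₜ (Fin n → ℂ) :=
    { toFun := S
      invFun := contraction P s
      left_inv := fun y => by
        simp only [S]; rw [contraction_contraction hP, mul_inv_cancel₀ hs', hid]
      right_inv := fun y => by
        simp only [S]; rw [contraction_contraction hP, inv_mul_cancel₀ hs', hid]
      continuous_toFun := hcont _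
      continuous_invFun := hcont _ }
  have hdetR : LinearMap.det (S.restrictScalars ℝ) = (s ^ (2 * γ))⁻¹ := by
    rw [LinearMap.det_restrictScalars, hdet, Algebra.norm_complex_apply, map_pow, map_inv₀,
      Complex.normSq_ofReal, pow_mul, inv_pow, pow_two]
  have hmap : Measure.map e (volume : Measure (Fin n → ℂ)) =
      ENNReal.ofReal (s ^ (2 * γ)) • volume := by
    have := Measure.map_linearMap_addHaar_eq_smul_addHaar
      (volume : Measure (Fin n → ℂ)) (f := S.restrictScalars ℝ) (by rw [hdetR]; positivity)
    rw [hdetR, inv_inv, abs_of_pos (by positivity)] at this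
    exact this
  have hF : ∀ x, F x = F (contraction P s (e x)) := fun x => congrArg F (e.left_inv x).symm
  calc ∫⁻ x in S ⁻¹' A, F x = ∫⁻ x in e ⁻¹' A, F (contraction P s (e x)) :=
        lintegral_congr hF
    _ = ∫⁻ x in A, F (contraction P s x) ∂(Measure.map e volume) := by
        rw [e.measurableEmbedding.restrict_map, e.measurableEmbedding.lintegral_map]
    _ = _ := by
        rw [hmap, Measure.restrict_smul, lintegral_smul_measure, smul_eq_mul]

open Filter Topology Asymptotics in
/-- `h` vanishes to order at least `k` along `V ∩ U`, on every complex line through a point of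
`V ∩ U`. -/
def VanishesTo {n : ℕ} (V : Submodule ℂ (Fin n → ℂ)) (k : ℕ) (U : Set (Fin n → ℂ))
    (h : (Fin n → ℂ) → ℂ) : Prop :=
  ∀ p ∈ U, p ∈ V → ∀ t : Fin n → ℂ, (fun z : ℂ => h (p + z • t)) =O[𝓝 0] fun z => z ^ k

theorem VanishesTo.mono {n : ℕ} {V : Submodule ℂ (Fin n → ℂ)} {k : ℕ} {U U' : Set (Fin n → ℂ)}
    {h : (Fin n → ℂ) → ℂ} (hv : VanishesTo V k U h) (hU : U' ⊆ U) : VanishesTo V k U' h :=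
  fun p hp => hv p (hU hp)

/-- Product neighbourhood of `p` adapted to a projection `P` fixing `p`. -/
def projBox {n : ℕ} (P : (Fin n → ℂ) →ₗ[ℂ] (Fin n → ℂ)) (p : Fin n → ℂ) (ρ : ℝ) :
    Set (Fin n → ℂ) :=
  {y | ‖P y - p‖ < ρ ∧ ‖y - P y‖ < ρ}

theorem isOpen_projBox {n : ℕ} (P : (Fin n → ℂ) →ₗ[ℂ] (Fin n → ℂ)) (p : Fin n → ℂ) (ρ : ℝ) :
    IsOpen (projBox P p ρ) := by
  have hP : Continuous P := P.continuous_of_finiteDimensional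
  have h1 : IsOpen {y | ‖P y - p‖ < ρ} := isOpen_lt (by fun_prop) continuous_const
  have h2 : IsOpen {y | ‖y - P y‖ < ρ} := isOpen_lt (by fun_prop) continuous_const
  exact h1.inter h2

theorem mem_projBox_self {n : ℕ} {P : (Fin n → ℂ) →ₗ[ℂ] (Fin n → ℂ)} {p : Fin n → ℂ} {ρ : ℝ}
    (hp : P p = p) (hρ : 0 < ρ) : p ∈ projBox P p ρ := by
  simp [projBox, hp, hρ]

theorem projBox_subset_ball {n : ℕ} (P : (Fin n → ℂ) →ₗ[ℂ] (Fin n → ℂ)) (p : Fin n → ℂ) (ρ : ℝ) :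
    projBox P p ρ ⊆ Metric.ball p (2 * ρ) := by
  rintro y ⟨h1, h2⟩
  rw [mem_ball_iff_norm]
  calc ‖y - p‖ = ‖(P y - p) + (y - P y)‖ := by congr 1; abel
    _ ≤ ‖P y - p‖ + ‖y - P y‖ := norm_add_le _ _
    _ < 2 * ρ := by linarith

theorem contraction_mem_projBox {n : ℕ} {P : (Fin n → ℂ) →ₗ[ℂ] (Fin n → ℂ)}
    (hP : ∀ y, P (P y) = P y) {p : Fin n → ℂ} {ρ : ℝ} {y : Fin n → ℂ} (hy : y ∈ projBox P p ρ)
    {c : ℂ} (hc : ‖c‖ ≤ 1) : contraction P c y ∈ projBox P p ρ := by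
  obtain ⟨h1, h2⟩ := hy
  have hPc : P (contraction P c y) = P y := by simp [contraction_apply, hP]
  refine ⟨by rwa [hPc], ?_⟩
  rw [hPc, contraction_apply, add_sub_cancel_left, norm_smul]
  exact (mul_le_of_le_one_left (norm_nonneg _) hc).trans_lt h2

open Filter Topology Asymptotics Metric in
/-- The restriction of a holomorphic function to the disc `z ↦ contraction P z y`. -/
theorem slice_properties {n k : ℕ} {V : Submodule ℂ (Fin n → ℂ)}
    {P : (Fin n → ℂ) →ₗ[ℂ] (Fin n → ℂ)} (hPV : ∀ y, P y ∈ V) (hP : ∀ y, P (P y) = P y)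
    {p : Fin n → ℂ} {ρ M : ℝ} {h : (Fin n → ℂ) → ℂ}
    (hd : DifferentiableOn ℂ h (projBox P p ρ)) (hM : ∀ y ∈ projBox P p ρ, ‖h y‖ ≤ M)
    (hv : VanishesTo V k (projBox P p ρ) h) {y : Fin n → ℂ} (hy : y ∈ projBox P p ρ) :
    DifferentiableOn ℂ (fun z : ℂ => h (contraction P z y)) (ball 0 1) ∧
      (∀ z ∈ ball (0 : ℂ) 1, ‖h (contraction P z y)‖ ≤ M) ∧
      (fun z : ℂ => h (contraction P z y)) =O[𝓝 0] fun z => z ^ k := by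
  have hmem : ∀ z ∈ ball (0 : ℂ) 1, contraction P z y ∈ projBox P p ρ := by
    intro z hz
    exact contraction_mem_projBox hP hy (mem_ball_zero_iff.1 hz).le
  refine ⟨?_, fun z hz => hM _ (hmem z hz), ?_⟩
  · refine hd.comp (f := fun z : ℂ => contraction P z y) ?_ hmem
    simp only [contraction_apply]
    fun_prop
  · have h0 : P y ∈ projBox P p ρ := by
      simpa [contraction_apply] using hmem 0 (mem_ball_self one_pos)
    simpa only [contraction_apply] using hv (P y) h0 (hPV y) (y - P y)

open Metric in
theorem norm_contraction_le {n k : ℕ} {V : Submodule ℂ (Fin n → ℂ)}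
    {P : (Fin n → ℂ) →ₗ[ℂ] (Fin n → ℂ)} (hPV : ∀ y, P y ∈ V) (hP : ∀ y, P (P y) = P y)
    {p : Fin n → ℂ} {ρ M : ℝ} {h : (Fin n → ℂ) → ℂ}
    (hd : DifferentiableOn ℂ h (projBox P p ρ)) (hM : ∀ y ∈ projBox P p ρ, ‖h y‖ ≤ M)
    (hv : VanishesTo V k (projBox P p ρ) h) {y : Fin n → ℂ} (hy : y ∈ projBox P p ρ) {z : ℂ}
    (hz : z ∈ ball (0 : ℂ) 1) : ‖h (contraction P z y)‖ ≤ M * ‖z‖ ^ k := by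
  obtain ⟨h1, h2, h3⟩ := slice_properties hPV hP hd hM hv hy
  exact norm_le_mul_pow_of_isBigO h1 h2 h3 hz

namespace Arrangement

variable {n : ℕ}

/-- The intersection of the hyperplanes indexed by `I`. -/
def center (D : Arrangement n) (I : Finset D.ι) : Submodule ℂ (Fin n → ℂ) :=
  ⨅ i ∈ I, LinearMap.ker (D.g i)

theorem mem_center {D : Arrangement n} {I : Finset D.ι} {x : Fin n → ℂ} :
    x ∈ D.center I ↔ ∀ i ∈ I, D.g i x = 0 := by
  simp [center, Submodule.mem_iInf]

/-- The factor of the defining polynomial indexed by `I`. -/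
def part (D : Arrangement n) (I : Finset D.ι) (x : Fin n → ℂ) : ℂ :=
  ∏ i ∈ I, D.g i x ^ D.m i

/-- The degree of the factor of the defining polynomial indexed by `I`. -/
def weight (D : Arrangement n) (I : Finset D.ι) : ℕ := ∑ i ∈ I, D.m i

theorem part_mul_part_sdiff (D : Arrangement n) {I J : Finset D.ι} (hJ : J ⊆ I)
    (x : Fin n → ℂ) : D.part J x * D.part (I \ J) x = D.part I x := by
  rw [part, part, part, mul_comm]
  exact Finset.prod_sdiff hJ

theorem part_univ (D : Arrangement n) : D.part Finset.univ = D.f := rfl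

theorem continuous_part (D : Arrangement n) (I : Finset D.ι) : Continuous (D.part I) := by
  have : ∀ i, Continuous (D.g i) := fun i => (D.g i).continuous_of_finiteDimensional
  unfold part
  fun_prop

theorem part_contraction (D : Arrangement n) {I : Finset D.ι} {P : (Fin n → ℂ) →ₗ[ℂ] (Fin n → ℂ)}
    (hP : ∀ y, P y ∈ D.center I) (c : ℂ) (y : Fin n → ℂ) :
    D.part I (contraction P c y) = c ^ D.weight I * D.part I y := by
  rw [part, part, weight, ← Finset.prod_pow_eq_pow_sum, ← Finset.prod_mul_distrib]
  refine Finset.prod_congr rfl fun i hi => ?_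
  have : D.g i (P y) = 0 := mem_center.1 (hP y) i hi
  rw [contraction_apply, map_add, map_smul, map_sub, this, zero_add, sub_zero, smul_eq_mul,
    mul_pow]

theorem ae_f_ne_zero (D : Arrangement n) : ∀ᵐ x : Fin n → ℂ, D.f x ≠ 0 := by
  have h : ∀ i, ∀ᵐ x : Fin n → ℂ, D.g i x ≠ 0 := by
    intro i
    have hne : (LinearMap.ker (D.g i)).restrictScalars ℝ ≠ ⊤ := by
      intro htop
      refine D.g_ne i (LinearMap.ext fun x => ?_)
      have : x ∈ (LinearMap.ker (D.g i)).restrictScalars ℝ := by rw [htop]; trivial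
      simpa using this
    have := Measure.addHaar_submodule (volume : Measure (Fin n → ℂ)) _ hne
    rw [ae_iff]
    convert this using 2
    ext x
    simp
  filter_upwards [ae_all_iff.2 h] with x hx
  exact Finset.prod_ne_zero_iff.2 fun i _ => pow_ne_zero _ (hx i)

open Filter Topology Asymptotics Metric in
/-- Integrability forces the leading coefficient along the edge to vanish if its order is too
small. -/
theorem tendsto_norm_contraction_div_pow (D : Arrangement n) {I : Finset D.ι} {k : ℕ} {β : ℝ}
    (hβ : 0 < β) {P : (Fin n → ℂ) →ₗ[ℂ] (Fin n → ℂ)} (hPV : ∀ y, P y ∈ D.center I)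
    (hP : ∀ y, P (P y) = P y)
    (hdet : ∀ c : ℂ, LinearMap.det (contraction P c) = c ^ D.gamma (D.center I))
    {p : Fin n → ℂ} {ρ M : ℝ} {g : (Fin n → ℂ) → ℂ}
    (hd : DifferentiableOn ℂ g (projBox P p ρ)) (hM : ∀ y ∈ projBox P p ρ, ‖g y‖ ≤ M)
    (hv : VanishesTo (D.center I) k (projBox P p ρ) g)
    (hinteg : ∫⁻ y in projBox P p ρ, ENNReal.ofReal (‖g y‖ ^ 2 * ‖D.f y‖ ^ (-2 * β)) ≠ ⊤)
    (hlt : (k : ℝ) + D.gamma (D.center I) < β * D.weight I)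
    {y : Fin n → ℂ} (hy : y ∈ projBox P p ρ) :
    Tendsto (fun s : ℝ => ‖g (contraction P s y)‖ / s ^ k) (𝓝[>] 0) (𝓝 0) := by
  set γ := D.gamma (D.center I)
  set w := D.weight I
  set R := projBox P p ρ with hR
  have hM0 : 0 ≤ M := (norm_nonneg _).trans (hM y hy)
  obtain ⟨C, hC0, hC⟩ : ∃ C : ℝ, 0 < C ∧ ∀ y ∈ R, ∀ s : ℝ, 0 < s → s < 1 →
      ‖D.f (contraction P s y)‖ ≤ C * s ^ w := by
    have hb : ∀ J : Finset D.ι, ∃ C : ℝ, ∀ y ∈ R, ‖D.part J y‖ ≤ C := by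
      intro J
      obtain ⟨C, hC⟩ := (isCompact_closedBall p (2 * ρ)).exists_bound_of_continuousOn
        (D.continuous_part J).continuousOn
      exact ⟨C, fun y hy => hC y (ball_subset_closedBall (projBox_subset_ball P p ρ hy))⟩
    obtain ⟨C1, h1⟩ := hb I
    obtain ⟨C2, h2⟩ := hb (Finset.univ \ I)
    have p1 : 0 ≤ C1 := (norm_nonneg _).trans (h1 y hy)
    have p2 : 0 ≤ C2 := (norm_nonneg _).trans (h2 y hy)
    refine ⟨C1 * C2 + 1, by positivity, fun y' hy' s hs hs1 => ?_⟩
    have hm := contraction_mem_projBox hP hy' (c := (s : ℂ))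
      (by simpa [abs_of_pos hs] using hs1.le)
    rw [← part_univ, ← D.part_mul_part_sdiff (Finset.subset_univ I), D.part_contraction hPV,
      norm_mul, norm_mul, norm_pow, Complex.norm_real, Real.norm_of_nonneg hs.le]
    have e1 := h1 y' hy'
    have e2 := h2 _ hm
    calc s ^ w * ‖D.part I y'‖ * ‖D.part (Finset.univ \ I) (contraction P s y')‖
        ≤ s ^ w * C1 * C2 := by gcongr
      _ = C1 * C2 * s ^ w := by ring
      _ ≤ _ := by gcongr; linarith
  rw [Metric.tendsto_nhds]
  intro ε hε
  obtain ⟨ρ₁, hρ₁, hball⟩ := Metric.isOpen_iff.1 (isOpen_projBox P p ρ) y hy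
  set δ := min ρ₁ (ε * ρ₁ / (4 * (M + 1))) with hδdef
  have hδ : 0 < δ := lt_min hρ₁ (by positivity)
  have hδ2 : 2 * M / ρ₁ * δ ≤ ε / 2 := by
    calc 2 * M / ρ₁ * δ ≤ 2 * M / ρ₁ * (ε * ρ₁ / (4 * (M + 1))) := by
          gcongr; exact min_le_right _ _
      _ = ε / 2 * (M / (M + 1)) := by field_simp; ring
      _ ≤ ε / 2 * 1 := by gcongr; exact (div_le_one (by positivity)).2 (by linarith)
      _ = ε / 2 := mul_one _
  set v := (volume (ball y δ)).toReal with hvdef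
  have hvol : volume (ball y δ) = ENNReal.ofReal v :=
    (ENNReal.ofReal_toReal measure_ball_lt_top.ne).symm
  have hv0 : 0 < v := ENNReal.toReal_pos (measure_ball_pos _ _ hδ).ne' measure_ball_lt_top.ne
  set τ := (∫⁻ y in R, ENNReal.ofReal (‖g y‖ ^ 2 * ‖D.f y‖ ^ (-2 * β))).toReal with hτ
  set e : ℝ := 2 * k + 2 * γ - 2 * β * w with he
  have hebig := (tendsto_rpow_neg_nhdsGT_zero (y := e) (by rw [he]; linarith)).eventually_gt_atTop
    (τ / ((ε / 2) ^ 2 * C ^ (-2 * β) * v))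
  filter_upwards [hebig, Ioo_mem_nhdsGT (zero_lt_one (α := ℝ))] with s hs1 ⟨hs0, hs1'⟩
  by_contra hcon
  rw [Real.dist_eq, sub_zero, abs_of_nonneg (by positivity), not_lt, le_div_iff₀ (by positivity)]
    at hcon
  have hsb : (s : ℂ) ∈ ball (0 : ℂ) 1 := by simpa [abs_of_pos hs0] using hs1'
  have hsn : ‖(s : ℂ)‖ = s := by simp [abs_of_pos hs0]
  have hS1 : ∀ y' ∈ R, ‖g (contraction P s y')‖ ≤ M * s ^ k := by
    intro y' hy'
    simpa only [hsn] using norm_contraction_le hPV hP hd hM hv hy' hsb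
  have hlow : ∀ y' ∈ ball y δ, ε / 2 * s ^ k ≤ ‖g (contraction P s y')‖ := by
    intro y' hy'
    have hy'1 : y' ∈ ball y ρ₁ := ball_subset_ball (min_le_left _ _) hy'
    have hdiff : DifferentiableOn ℂ (fun y' => g (contraction P s y')) (ball y ρ₁) := by
      refine hd.comp (f := fun y' => contraction P s y') ?_ ?_
      · exact ((contraction P s).toContinuousLinearMap).differentiable.differentiableOn
      · intro z hz
        exact contraction_mem_projBox hP (hball hz) (by rw [hsn]; exact hs1'.le)
    have hmaps : Set.MapsTo (fun y' => g (contraction P s y')) (ball y ρ₁)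
        (closedBall (g (contraction P s y)) (2 * (M * s ^ k))) := by
      intro z hz
      rw [mem_closedBall, dist_eq_norm]
      refine (norm_sub_le _ _).trans ?_
      linarith [hS1 z (hball hz), hS1 y hy]
    have h := Complex.dist_le_div_mul_dist_of_mapsTo_ball hdiff hmaps hy'1
    have h2 : 2 * (M * s ^ k) / ρ₁ * dist y' y ≤ ε / 2 * s ^ k := by
      calc 2 * (M * s ^ k) / ρ₁ * dist y' y ≤ 2 * (M * s ^ k) / ρ₁ * δ := by
            gcongr; exact (mem_ball.1 hy').le
        _ = (2 * M / ρ₁ * δ) * s ^ k := by ring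
        _ ≤ _ := by gcongr
    have h3 := norm_sub_norm_le (g (contraction P s y)) (g (contraction P s y'))
    rw [dist_comm, dist_eq_norm] at h
    linarith
  set X := (contraction P ((s : ℂ)⁻¹)) ⁻¹' ball y δ with hX
  have hXr : ∀ z ∈ X, ∃ y' ∈ ball y δ, z = contraction P s y' := by
    intro z hz
    refine ⟨_, hz, ?_⟩
    rw [contraction_contraction hP, mul_inv_cancel₀ (by exact_mod_cast hs0.ne')]
    simp [contraction_apply]
  have hyR : ∀ y' ∈ ball y δ, y' ∈ R := fun y' h => hball (ball_subset_ball (min_le_left _ _) h)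
  have hXR : X ⊆ R := by
    intro z hz
    obtain ⟨y', hy', rfl⟩ := hXr z hz
    exact contraction_mem_projBox hP (hyR y' hy') (by rw [hsn]; exact hs1'.le)
  have hvolX : volume X = ENNReal.ofReal (s ^ (2 * γ)) * volume (ball y δ) := by
    simpa using setLIntegral_contraction hP hdet hs0 (ball y δ) (fun _ => 1)
  have hXm : MeasurableSet X :=
    (isOpen_ball.preimage (contraction P ((s : ℂ)⁻¹)).continuous_of_finiteDimensional).measurableSet
  have hkey : ENNReal.ofReal ((ε / 2 * s ^ k) ^ 2 * (C * s ^ w) ^ (-2 * β)) * volume X ≤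
      ∫⁻ y in R, ENNReal.ofReal (‖g y‖ ^ 2 * ‖D.f y‖ ^ (-2 * β)) := by
    rw [← setLIntegral_const]
    refine le_trans (setLIntegral_mono_ae' hXm ?_) (lintegral_mono_set hXR)
    filter_upwards [D.ae_f_ne_zero] with z hz hzX
    obtain ⟨y', hy', rfl⟩ := hXr z hzX
    refine ENNReal.ofReal_le_ofReal ?_
    exact mul_le_mul (pow_le_pow_left₀ (by positivity) (hlow y' hy') 2)
      (Real.rpow_le_rpow_of_nonpos (norm_pos_iff.2 hz) (hC y' (hyR y' hy') s hs0 hs1')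
        (by linarith)) (by positivity) (by positivity)
  rw [hvolX, hvol, ← ENNReal.ofReal_mul (by positivity), ← ENNReal.ofReal_mul (by positivity),
    ← ENNReal.ofReal_toReal hinteg, ← hτ, ENNReal.ofReal_le_ofReal_iff ENNReal.toReal_nonneg] at hkey
  have hpow : (ε / 2 * s ^ k) ^ 2 * (C * s ^ w) ^ (-2 * β) * (s ^ (2 * γ) * v) =
      s ^ e * ((ε / 2) ^ 2 * C ^ (-2 * β) * v) := by
    have : s ^ e = s ^ (2 * k) * s ^ (2 * γ) * (s ^ w) ^ (-2 * β) := by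
      rw [← Real.rpow_natCast s (2 * k), ← Real.rpow_natCast s (2 * γ), ← Real.rpow_natCast s w,
        ← Real.rpow_mul hs0.le, ← Real.rpow_add hs0, ← Real.rpow_add hs0, he]
      congr 1; push_cast; ring
    rw [this, Real.mul_rpow hC0.le (by positivity)]
    ring
  rw [hpow] at hkey
  rw [div_lt_iff₀ (by positivity)] at hs1
  linarith

open Filter Topology Asymptotics Metric in
theorem vanishesTo_succ (D : Arrangement n) {I : Finset D.ι} {k : ℕ} {β : ℝ}
    (hβ : 0 < β) {U : Set (Fin n → ℂ)} (hU : IsOpen U) {M : ℝ} {g : (Fin n → ℂ) → ℂ}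
    (hd : DifferentiableOn ℂ g U) (hM : ∀ y ∈ U, ‖g y‖ ≤ M)
    (hv : VanishesTo (D.center I) k U g)
    (hinteg : ∫⁻ y in U, ENNReal.ofReal (‖g y‖ ^ 2 * ‖D.f y‖ ^ (-2 * β)) ≠ ⊤)
    (hlt : (k : ℝ) + D.gamma (D.center I) < β * D.weight I) :
    VanishesTo (D.center I) (k + 1) U g := by
  intro p hpU hp t
  obtain ⟨P, hPV, hPfix, hdet⟩ := exists_proj (D.center I)
  have hP : ∀ y, P (P y) = P y := fun y => hPfix _ (hPV y)
  obtain ⟨r, hr, hball⟩ := Metric.isOpen_iff.1 hU p hpU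
  set ρ := r / 2 with hρ
  have hρ0 : 0 < ρ := by positivity
  have hRU : projBox P p ρ ⊆ U :=
    (projBox_subset_ball P p ρ).trans (by rw [hρ, mul_div_cancel₀ _ two_ne_zero]; exact hball)
  have hd' := hd.mono hRU
  have hM' : ∀ y ∈ projBox P p ρ, ‖g y‖ ≤ M := fun y hy => hM y (hRU hy)
  have hv' := hv.mono hRU
  have hinteg' : ∫⁻ y in projBox P p ρ, ENNReal.ofReal (‖g y‖ ^ 2 * ‖D.f y‖ ^ (-2 * β)) ≠ ⊤ :=
    ne_top_of_le_ne_top hinteg (lintegral_mono_set hRU)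
  have hbound : ∀ y ∈ projBox P p ρ, ∀ z ∈ ball (0 : ℂ) 1,
      ‖g (contraction P z y)‖ ≤ M * ‖z‖ ^ (k + 1) := by
    intro y hy z hz
    obtain ⟨h1, h2, h3⟩ := slice_properties hPV hP hd' hM' hv' hy
    exact norm_le_mul_pow_succ_of_tendsto h1 h2 h3
      (D.tendsto_norm_contraction_div_pow hβ hPV hP hdet hd' hM' hv' hinteg' hlt hy) hz
  set q := t - P t with hq
  set c : ℝ := ρ / (‖q‖ + 1) with hc
  have hc0 : 0 < c := by positivity
  have hc0' : (c : ℂ) ≠ 0 := by exact_mod_cast hc0.ne'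
  have hcq : ‖(c : ℂ) • q‖ < ρ := by
    rw [norm_smul, Complex.norm_real, Real.norm_of_nonneg hc0.le, hc, div_mul_eq_mul_div,
      div_lt_iff₀ (by positivity)]
    nlinarith
  have hPq : P q = 0 := by simp [hq, hP]
  have hz1 : ∀ᶠ z : ℂ in 𝓝 0, ‖z • P t‖ < ρ := by
    have : Continuous fun z : ℂ => ‖z • P t‖ := by fun_prop
    exact (this.tendsto 0).eventually_lt_const (by simpa using hρ0)
  have hz2 : ∀ᶠ z : ℂ in 𝓝 0, ‖z / c‖ < 1 := by
    have : Continuous fun z : ℂ => ‖z / c‖ := by fun_prop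
    exact (this.tendsto 0).eventually_lt_const (by simp)
  refine IsBigO.of_bound (M * (c⁻¹) ^ (k + 1)) ?_
  filter_upwards [hz1, hz2] with z h1 h2
  have hPy : P (p + z • P t + (c : ℂ) • q) = p + z • P t := by
    simp [hPq, hP, hPfix p hp]
  have hy : p + z • P t + (c : ℂ) • q ∈ projBox P p ρ := by
    refine ⟨?_, ?_⟩
    · rw [hPy, add_sub_cancel_left]; exact h1
    · rw [hPy, add_sub_cancel_left]; exact hcq
  have h := hbound _ hy (z / c) (by simpa using h2)
  have heq : contraction P (z / c) (p + z • P t + (c : ℂ) • q) = p + z • t := by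
    rw [contraction_apply, hPy, add_sub_cancel_left, smul_smul, div_mul_cancel₀ _ hc0', hq]
    module
  rw [heq] at h
  refine h.trans_eq ?_
  rw [norm_div, Complex.norm_real, Real.norm_of_nonneg hc0.le, norm_pow, div_eq_mul_inv, mul_pow]
  ring

open Filter Topology Metric in
/-- Negative powers of `D.part I` are locally controlled by those of the factor vanishing at a
given point. -/
theorem exists_norm_part_rpow_le (D : Arrangement n) (I : Finset D.ι) (a : Fin n → ℂ) (α : ℝ) :
    ∃ C : ℝ, 0 < C ∧ ∀ᶠ z in 𝓝 a, ‖D.part I z‖ ^ (-2 * α) ≤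
      C * ‖D.part (I.filter fun i => D.g i a = 0) z‖ ^ (-2 * α) := by
  set J := I.filter fun i => D.g i a = 0
  have hne : D.part (I \ J) a ≠ 0 := by
    refine Finset.prod_ne_zero_iff.2 fun i hi => pow_ne_zero _ fun h0 => ?_
    rw [Finset.mem_sdiff, Finset.mem_filter] at hi
    exact hi.2 ⟨hi.1, h0⟩
  have hc : ContinuousAt (fun z => ‖D.part (I \ J) z‖ ^ (-2 * α)) a :=
    ((D.continuous_part _).norm.continuousAt).rpow_const (Or.inl (norm_ne_zero_iff.2 hne))
  refine ⟨‖D.part (I \ J) a‖ ^ (-2 * α) + 1, by positivity, ?_⟩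
  filter_upwards [hc.tendsto.eventually_lt_const (lt_add_one _)] with z hz
  rw [← D.part_mul_part_sdiff (show J ⊆ I from Finset.filter_subset _ _), norm_mul,
    Real.mul_rpow (norm_nonneg _) (norm_nonneg _), mul_comm]
  gcongr

open Filter Topology Metric in
/-- Local integrability, with a uniform bound, of `|h|² |f|^(-2α)` for all holomorphic `h`
vanishing to sufficiently high order along all edges. -/
theorem exists_setLIntegral_le (D : Arrangement n) {α : ℝ} (hα : 0 < α) (K : Finset D.ι → ℕ)
    (hK : ∀ J : Finset D.ι, J.Nonempty →
      α * D.weight J < (K J : ℝ) + D.gamma (D.center J)) (I : Finset D.ι) :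
    ∀ p ∈ D.center I, ∀ r : ℝ, 0 < r → ∃ ρ : ℝ, 0 < ρ ∧ ∃ C : ENNReal, C ≠ ⊤ ∧
      ∀ (h : (Fin n → ℂ) → ℂ) (M : ℝ), DifferentiableOn ℂ h (ball p r) →
        (∀ y ∈ ball p r, ‖h y‖ ≤ M) →
        (∀ J ⊆ I, J.Nonempty → VanishesTo (D.center J) (K J) (ball p r) h) →
        ∫⁻ y in ball p ρ, ENNReal.ofReal (‖h y‖ ^ 2 * ‖D.part I y‖ ^ (-2 * α)) ≤
          C * ENNReal.ofReal (M ^ 2) := by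
  induction I using Finset.strongInduction with
  | H I ih =>
  intro p hp r hr
  rcases I.eq_empty_or_nonempty with rfl | hI
  · refine ⟨r, hr, volume (ball p r), measure_ball_lt_top.ne, fun h M _ hM _ => ?_⟩
    rw [mul_comm (volume _), ← setLIntegral_const]
    refine setLIntegral_mono' measurableSet_ball fun y hy => ENNReal.ofReal_le_ofReal ?_
    have := hM y hy
    simp only [part, Finset.prod_empty, norm_one, Real.one_rpow, mul_one]
    gcongr
  obtain ⟨P, hPV, hPfix, hdet⟩ := exists_proj (D.center I)
  have hP : ∀ y, P (P y) = P y := fun y => hPfix _ (hPV y)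
  have hPc : Continuous P := P.continuous_of_finiteDimensional
  have hPp : P p = p := hPfix p hp
  set ρ := r / 4 with hρ
  have hρ0 : 0 < ρ := by positivity
  set R := projBox P p (2 * ρ) with hR
  have hRr : R ⊆ ball p r := by
    refine (projBox_subset_ball P p (2 * ρ)).trans (ball_subset_ball ?_)
    rw [hρ]; linarith
  set A : Set (Fin n → ℂ) := {y | ‖P y - p‖ ≤ ρ ∧ ρ / 2 ≤ ‖y - P y‖ ∧ ‖y - P y‖ ≤ ρ} with hA
  have hAR : A ⊆ R := fun y hy => ⟨by linarith [hy.1], by linarith [hy.2.2]⟩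
  have hAcl : IsClosed A := by
    have h1 : IsClosed {y | ‖P y - p‖ ≤ ρ} := isClosed_le (by fun_prop) continuous_const
    have h2 : IsClosed {y | ρ / 2 ≤ ‖y - P y‖} := isClosed_le continuous_const (by fun_prop)
    have h3 : IsClosed {y | ‖y - P y‖ ≤ ρ} := isClosed_le (by fun_prop) continuous_const
    exact h1.inter (h2.inter h3)
  have hAc : IsCompact A :=
    (isCompact_closedBall p r).of_isClosed_subset hAcl
      ((hAR.trans hRr).trans ball_subset_closedBall)
  obtain ⟨C, hC, hCA⟩ : ∃ C : ENNReal, C ≠ ⊤ ∧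
      ∀ (h : (Fin n → ℂ) → ℂ) (M : ℝ), DifferentiableOn ℂ h R → (∀ y ∈ R, ‖h y‖ ≤ M) →
        (∀ J ⊆ I, J.Nonempty → VanishesTo (D.center J) (K J) R h) →
        ∫⁻ y in A, ENNReal.ofReal (‖h y‖ ^ 2 * ‖D.part I y‖ ^ (-2 * α)) ≤
          C * ENNReal.ofReal (M ^ 2) := by
    refine hAc.induction_on (p := fun s => ∃ C : ENNReal, C ≠ ⊤ ∧
      ∀ (h : (Fin n → ℂ) → ℂ) (M : ℝ), DifferentiableOn ℂ h R → (∀ y ∈ R, ‖h y‖ ≤ M) →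
        (∀ J ⊆ I, J.Nonempty → VanishesTo (D.center J) (K J) R h) →
        ∫⁻ y in s, ENNReal.ofReal (‖h y‖ ^ 2 * ‖D.part I y‖ ^ (-2 * α)) ≤
          C * ENNReal.ofReal (M ^ 2)) ⟨0, by simp, by simp⟩ ?_ ?_ ?_
    · rintro s t hst ⟨C, hC, h'⟩
      exact ⟨C, hC, fun h M h1 h2 h3 => (lintegral_mono_set hst).trans (h' h M h1 h2 h3)⟩
    · rintro s t ⟨C1, hC1, h1'⟩ ⟨C2, hC2, h2'⟩
      refine ⟨C1 + C2, ENNReal.add_ne_top.2 ⟨hC1, hC2⟩, fun h M h1 h2 h3 => ?_⟩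
      rw [add_mul]
      exact (lintegral_union_le _ _ _).trans (add_le_add (h1' h M h1 h2 h3) (h2' h M h1 h2 h3))
    · intro a ha
      obtain ⟨ra, hra, hballa⟩ := Metric.isOpen_iff.1 (isOpen_projBox P p (2 * ρ)) a (hAR ha)
      set J := I.filter fun i => D.g i a = 0 with hJ
      have hJI : J ⊂ I := by
        refine Finset.filter_ssubset.2 ?_
        by_contra! hcon
        have : P a = a := hPfix a (mem_center.2 hcon)
        have h2 := ha.2.1
        rw [this, sub_self, norm_zero] at h2
        linarith
      have haJ : a ∈ D.center J := mem_center.2 fun i hi => (Finset.mem_filter.1 hi).2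
      obtain ⟨ρa, hρa, Ca, hCa, hinteg⟩ := ih J hJI a haJ ra hra
      obtain ⟨B, hB, hBa⟩ := D.exists_norm_part_rpow_le I a α
      obtain ⟨ε, hε, hεB⟩ := Metric.eventually_nhds_iff_ball.1 hBa
      refine ⟨ball a (min ρa ε),
        mem_nhdsWithin_of_mem_nhds (ball_mem_nhds a (lt_min hρa hε)),
        ENNReal.ofReal B * Ca, ENNReal.mul_ne_top ENNReal.ofReal_ne_top hCa,
        fun h M h1 h2 h3 => ?_⟩
      have hh := hinteg h M (h1.mono hballa) (fun y hy => h2 y (hballa hy))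
        (fun J' hJ' hne => (h3 J' (hJ'.trans hJI.1) hne).mono hballa)
      calc ∫⁻ y in ball a (min ρa ε), ENNReal.ofReal (‖h y‖ ^ 2 * ‖D.part I y‖ ^ (-2 * α))
          ≤ ∫⁻ y in ball a (min ρa ε), ENNReal.ofReal B *
              ENNReal.ofReal (‖h y‖ ^ 2 * ‖D.part J y‖ ^ (-2 * α)) := by
            refine setLIntegral_mono' measurableSet_ball fun y hy => ?_
            rw [← ENNReal.ofReal_mul hB.le]
            refine ENNReal.ofReal_le_ofReal ?_
            rw [mul_left_comm]
            gcongr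
            exact hεB y (ball_subset_ball (min_le_right _ _) hy)
        _ = ENNReal.ofReal B * ∫⁻ y in ball a (min ρa ε),
              ENNReal.ofReal (‖h y‖ ^ 2 * ‖D.part J y‖ ^ (-2 * α)) :=
            lintegral_const_mul' _ _ ENNReal.ofReal_ne_top
        _ ≤ ENNReal.ofReal B * (Ca * ENNReal.ofReal (M ^ 2)) := by
            gcongr
            exact (lintegral_mono_set (ball_subset_ball (min_le_left _ _))).trans hh
        _ = _ := (mul_assoc _ _ _).symm
  set γ := D.gamma (D.center I)
  set w := D.weight I
  set q : ℝ := (1 / 2 : ℝ) ^ (2 * (K I : ℝ) + 2 * γ - 2 * α * w) with hq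
  have hq0 : 0 ≤ q := by positivity
  have hq1 : q < 1 := Real.rpow_lt_one (by norm_num) (by norm_num) (by linarith [hK I hI])
  have hq1' : ENNReal.ofReal q < 1 := by
    rw [← ENNReal.ofReal_one]; exact (ENNReal.ofReal_lt_ofReal_iff one_pos).2 hq1
  obtain ⟨ρ', hρ', hball'⟩ := Metric.isOpen_iff.1 (isOpen_projBox P p ρ) p
    (mem_projBox_self hPp hρ0)
  refine ⟨ρ', hρ', (1 - ENNReal.ofReal q)⁻¹ * C,
    ENNReal.mul_ne_top (ENNReal.inv_ne_top.2 (tsub_pos_of_lt hq1').ne') hC,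
    fun h M hd hM hv => ?_⟩
  set F : (Fin n → ℂ) → ENNReal :=
    fun y => ENNReal.ofReal (‖h y‖ ^ 2 * ‖D.part I y‖ ^ (-2 * α)) with hF
  have hF0 : ∀ y ∈ (D.center I : Set (Fin n → ℂ)), F y = 0 := by
    intro y hy
    obtain ⟨i, hi⟩ := hI
    have : D.part I y = 0 :=
      Finset.prod_eq_zero hi (by rw [mem_center.1 hy i hi, zero_pow (D.m_pos i).ne'])
    simp only [hF, this, norm_zero]
    rw [Real.zero_rpow (by linarith), mul_zero, ENNReal.ofReal_zero]
  set B : ℕ → Set (Fin n → ℂ) :=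
    fun j => (contraction P ((((1 / 2 : ℝ) ^ j : ℝ) : ℂ)⁻¹)) ⁻¹' A with hB
  have hcover : projBox P p ρ ⊆ (D.center I : Set (Fin n → ℂ)) ∪ ⋃ j, B j := by
    intro y hy
    rcases eq_or_ne (y - P y) 0 with h0 | h0
    · left
      rw [sub_eq_zero.1 h0]; exact hPV y
    · right
      have hpos : 0 < ‖y - P y‖ := norm_pos_iff.2 h0
      obtain ⟨j, hj1, hj2⟩ := exists_nat_pow_near_of_lt_one (x := ‖y - P y‖ / ρ)
        (y := (1 / 2 : ℝ)) (by positivity) ((div_le_one hρ0).2 hy.2.le) (by norm_num)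
        (by norm_num)
      set s : ℝ := (1 / 2 : ℝ) ^ j with hs
      have hs0 : 0 < s := by positivity
      rw [pow_succ, ← hs, lt_div_iff₀ hρ0] at hj1
      rw [div_le_iff₀ hρ0] at hj2
      have hPy : P (contraction P ((s : ℂ)⁻¹) y) = P y := by simp [contraction_apply, hP]
      refine Set.mem_iUnion.2 ⟨j, ?_⟩
      change contraction P ((s : ℂ)⁻¹) y ∈ A
      have hn : ‖contraction P ((s : ℂ)⁻¹) y - P y‖ = s⁻¹ * ‖y - P y‖ := by
        rw [contraction_apply, add_sub_cancel_left, norm_smul, norm_inv, Complex.norm_real,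
          Real.norm_of_nonneg hs0.le]
      refine ⟨by rw [hPy]; exact hy.1.le, ?_, ?_⟩
      · rw [hPy, hn, inv_mul_eq_div, le_div_iff₀ hs0]; linarith
      · rw [hPy, hn, inv_mul_eq_div, div_le_iff₀ hs0]; linarith
  have hpiece : ∀ j, ∫⁻ y in B j, F y ≤ ENNReal.ofReal q ^ j * (C * ENNReal.ofReal (M ^ 2)) := by
    intro j
    rcases j.eq_zero_or_pos with rfl | hj
    · have hB0 : B 0 = A := by
        ext y
        simp [hB, contraction_apply]
      rw [hB0, pow_zero, one_mul]
      exact hCA h M (hd.mono hRr) (fun y hy => hM y (hRr hy))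
        (fun J hJ hne => (hv J hJ hne).mono hRr)
    set s : ℝ := (1 / 2 : ℝ) ^ j with hs
    have hs0 : 0 < s := by positivity
    have hs1 : s < 1 := pow_lt_one₀ (by norm_num) (by norm_num) hj.ne'
    have hsn : ‖(s : ℂ)‖ = s := by rw [Complex.norm_real, Real.norm_of_nonneg hs0.le]
    have hsb : (s : ℂ) ∈ ball (0 : ℂ) 1 := by rw [mem_ball_zero_iff, hsn]; exact hs1
    have hmem : ∀ y ∈ R, contraction P s y ∈ R := fun y hy =>
      contraction_mem_projBox hP hy (by rw [hsn]; exact hs1.le)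
    have hgood := hCA (fun y => h (contraction P s y)) (M * s ^ K I) ?_ ?_ ?_
    · change ∫⁻ y in (contraction P ((s : ℂ)⁻¹)) ⁻¹' A, F y ≤ _
      rw [setLIntegral_contraction hP hdet hs0]
      have hFs : ∀ y, F (contraction P s y) = ENNReal.ofReal ((s ^ w) ^ (-2 * α)) *
          ENNReal.ofReal (‖h (contraction P s y)‖ ^ 2 * ‖D.part I y‖ ^ (-2 * α)) := by
        intro y
        simp only [hF]
        rw [← ENNReal.ofReal_mul (by positivity), D.part_contraction hPV, norm_mul, norm_pow, hsn,
          Real.mul_rpow (by positivity) (norm_nonneg _), mul_left_comm]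
      simp only [hFs]
      rw [lintegral_const_mul' _ _ ENNReal.ofReal_ne_top]
      have hqj : q ^ j = s ^ (2 * γ) * (s ^ w) ^ (-2 * α) * (s ^ K I) ^ 2 := by
        have h1 : q ^ j = s ^ (2 * (K I : ℝ) + 2 * γ - 2 * α * w) := by
          rw [hq, hs, ← Real.rpow_natCast, ← Real.rpow_natCast, ← Real.rpow_mul (by norm_num),
            ← Real.rpow_mul (by norm_num), mul_comm]
        rw [h1, ← pow_mul s (K I) 2, ← Real.rpow_natCast s (K I * 2), ← Real.rpow_natCast s (2 * γ),
          ← Real.rpow_natCast s w, ← Real.rpow_mul hs0.le, ← Real.rpow_add hs0,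
          ← Real.rpow_add hs0]
        congr 1; push_cast; ring
      calc ENNReal.ofReal (s ^ (2 * γ)) * (ENNReal.ofReal ((s ^ w) ^ (-2 * α)) *
            ∫⁻ y in A, ENNReal.ofReal (‖h (contraction P s y)‖ ^ 2 * ‖D.part I y‖ ^ (-2 * α)))
          ≤ ENNReal.ofReal (s ^ (2 * γ)) * (ENNReal.ofReal ((s ^ w) ^ (-2 * α)) *
            (C * ENNReal.ofReal ((M * s ^ K I) ^ 2))) := by gcongr
        _ = ENNReal.ofReal q ^ j * (C * ENNReal.ofReal (M ^ 2)) := by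
            rw [← ENNReal.ofReal_pow hq0, hqj, ENNReal.ofReal_mul (by positivity),
              ENNReal.ofReal_mul (by positivity), mul_pow, ENNReal.ofReal_mul (by positivity)]
            ring
    · exact (hd.mono hRr).comp
        ((contraction P (s : ℂ)).toContinuousLinearMap).differentiable.differentiableOn hmem
    · intro y hy
      simpa only [hsn] using norm_contraction_le hPV hP (hd.mono hRr)
        (fun y hy => hM y (hRr hy)) ((hv I subset_rfl hI).mono hRr) hy hsb
    · intro J hJ hne a haR ha t
      have haJ : contraction P s a ∈ D.center J := by
        refine mem_center.2 fun i hi => ?_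
        have h1 : D.g i (P a) = 0 := mem_center.1 (hPV a) i (hJ hi)
        have h2 : D.g i a = 0 := mem_center.1 ha i hi
        simp [contraction_apply, h1, h2]
      simpa only [map_add, map_smul] using
        hv J hJ hne _ (hRr (hmem a haR)) haJ (contraction P s t)
  calc ∫⁻ y in ball p ρ', F y
      ≤ ∫⁻ y in (D.center I : Set (Fin n → ℂ)) ∪ ⋃ j, B j, F y :=
        lintegral_mono_set (hball'.trans hcover)
    _ ≤ (∫⁻ y in (D.center I : Set (Fin n → ℂ)), F y) + ∫⁻ y in ⋃ j, B j, F y :=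
        lintegral_union_le _ _ _
    _ = ∫⁻ y in ⋃ j, B j, F y := by
        rw [setLIntegral_congr_fun (Submodule.closed_of_finiteDimensional _).measurableSet hF0,
          lintegral_zero, zero_add]
    _ ≤ ∑' j, ∫⁻ y in B j, F y := lintegral_iUnion_le _ _
    _ ≤ ∑' j, ENNReal.ofReal q ^ j * (C * ENNReal.ofReal (M ^ 2)) := ENNReal.tsum_le_tsum hpiece
    _ = _ := by rw [ENNReal.tsum_mul_right, ENNReal.tsum_geometric, mul_assoc]

theorem center_mem_edges (D : Arrangement n) {I : Finset D.ι} (hI : I.Nonempty) :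
    D.center I ∈ D.edges :=
  ⟨I, by simpa using hI, by simp [center]⟩

theorem subset_filter_center_le (D : Arrangement n) (I : Finset D.ι) :
    I ⊆ Finset.univ.filter fun i => D.center I ≤ LinearMap.ker (D.g i) := fun i hi =>
  Finset.mem_filter.2 ⟨Finset.mem_univ i, fun _ hx => mem_center.1 hx i hi⟩

theorem weight_le_mu_center (D : Arrangement n) (I : Finset D.ι) :
    D.weight I ≤ D.mu (D.center I) :=
  Finset.sum_le_sum_of_subset (D.subset_filter_center_le I)

theorem mu_center_pos (D : Arrangement n) {I : Finset D.ι} (hI : I.Nonempty) :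
    0 < D.mu (D.center I) :=
  (Finset.sum_pos (fun i _ => D.m_pos i) hI).trans_le (D.weight_le_mu_center I)

theorem center_filter_center_le (D : Arrangement n) (I : Finset D.ι) :
    D.center (Finset.univ.filter fun i => D.center I ≤ LinearMap.ker (D.g i)) = D.center I := by
  refine le_antisymm (fun y hy => mem_center.2 fun i hi => ?_)
    fun y hy => mem_center.2 fun i hi => ?_
  · exact mem_center.1 hy i (D.subset_filter_center_le I hi)
  · exact (Finset.mem_filter.1 hi).2 hy

end Arrangement

open Filter Topology Metric in
/-- **Consequence of Proposition 1.** Every jumping coefficient `α ∈ (0,1)` of a central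
essential arrangement of degree `d > n` satisfies `α·μ(V) ∈ ℤ` for some edge `V` with
`μ(V) > γ(V)`. -/
theorem jc_denominator_divides_edge_multiplicity {n : ℕ} (D : Arrangement n)
    (hess : D.Essential) (hd : n < D.degree)
    (α : ℝ) (hJC : α ∈ D.JC) (h0 : 0 < α) (h1 : α < 1) :
    ∃ V ∈ D.edges, D.gamma V < D.mu V ∧ ∃ k : ℤ, α * (D.mu V : ℝ) = (k : ℝ) := by
  obtain ⟨-, x, U, g, hU, hgd, hinteg, hnot⟩ := hJC
  by_contra! hcon
  have hstrict : ∀ J : Finset D.ι, J.Nonempty → ∀ k : ℕ,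
      (k : ℝ) + D.gamma (D.center J) ≤ α * D.mu (D.center J) →
      (k : ℝ) + D.gamma (D.center J) < α * D.mu (D.center J) := by
    intro J hJ k hk
    refine hk.lt_of_ne fun heq => ?_
    have hpos : (0 : ℝ) < D.mu (D.center J) := by exact_mod_cast D.mu_center_pos hJ
    have hlt : (D.gamma (D.center J) : ℝ) < D.mu (D.center J) := by
      have : (0 : ℝ) ≤ k := k.cast_nonneg
      nlinarith
    refine hcon _ (D.center_mem_edges hJ) (by exact_mod_cast hlt) (k + D.gamma (D.center J)) ?_
    rw [← heq]
    push_cast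
    rfl
  have hex : ∀ J : Finset D.ι,
      ∃ k : ℕ, α * D.mu (D.center J) < (k : ℝ) + D.gamma (D.center J) := fun J => by
    obtain ⟨k, hk⟩ := exists_nat_gt (α * D.mu (D.center J))
    exact ⟨k, hk.trans_le (le_add_of_nonneg_right (Nat.cast_nonneg _))⟩
  set K : Finset D.ι → ℕ := fun J => Nat.find (hex J) with hK
  have hKspec : ∀ J, α * D.mu (D.center J) < (K J : ℝ) + D.gamma (D.center J) :=
    fun J => Nat.find_spec (hex J)
  have hKmin : ∀ J, ∀ k < K J, (k : ℝ) + D.gamma (D.center J) ≤ α * D.mu (D.center J) :=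
    fun J k hk => not_lt.1 (Nat.find_min (hex J) hk)
  obtain ⟨β, ⟨hβ0, hβα⟩, hβ⟩ : ∃ β, (0 < β ∧ β < α) ∧ ∀ J : Finset D.ι, ∀ k ∈ Finset.range (K J),
      J.Nonempty → (k : ℝ) + D.gamma (D.center J) < β * D.mu (D.center J) := by
    have hev : ∀ᶠ β in 𝓝[<] α, ∀ J : Finset D.ι, ∀ k ∈ Finset.range (K J),
        J.Nonempty → (k : ℝ) + D.gamma (D.center J) < β * D.mu (D.center J) := by
      refine Filter.eventually_all.2 fun J => (Filter.eventually_all_finset _).2 fun k hk => ?_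
      by_cases hJ : J.Nonempty
      · have hc : Tendsto (fun β : ℝ => β * D.mu (D.center J)) (𝓝[<] α)
            (𝓝 (α * D.mu (D.center J))) :=
          ((continuous_id.mul continuous_const).tendsto α).mono_left nhdsWithin_le_nhds
        filter_upwards [hc.eventually_const_lt
          (hstrict J hJ k (hKmin J k (Finset.mem_range.1 hk)))] with β hβ _
        exact hβ
      · exact Filter.Eventually.of_forall fun β h => absurd h hJ
    obtain ⟨β, h, hβ⟩ := (hev.and (Ioo_mem_nhdsLT h0)).exists
    exact ⟨β, hβ, h⟩
  obtain ⟨W, hW, hWint⟩ := hinteg β hβ0 hβα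
  obtain ⟨r, hr, hrUW⟩ := Metric.nhds_basis_closedBall.mem_iff.1 (Filter.inter_mem hU hW)
  have hballU : ball x r ⊆ U := ball_subset_closedBall.trans (hrUW.trans Set.inter_subset_left)
  have hd' : DifferentiableOn ℂ g (ball x r) := hgd.mono hballU
  obtain ⟨M, hM⟩ := (isCompact_closedBall x r).exists_bound_of_continuousOn
    (hgd.continuousOn.mono (hrUW.trans Set.inter_subset_left))
  have hM' : ∀ y ∈ ball x r, ‖g y‖ ≤ M := fun y hy => hM y (ball_subset_closedBall hy)
  have hfin : ∫⁻ y in ball x r, ENNReal.ofReal (‖g y‖ ^ 2 * ‖D.f y‖ ^ (-2 * β)) ≠ ⊤ :=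
    ((hWint.mono_set
      (ball_subset_closedBall.trans (hrUW.trans Set.inter_subset_right))).lintegral_lt_top).ne
  have hvan : ∀ J : Finset D.ι, J.Nonempty → ∀ k ≤ K J,
      VanishesTo (D.center J) k (ball x r) g := by
    intro J hJ k
    induction k with
    | zero =>
      intro _ p hp _ t
      have hc : ContinuousAt (fun z : ℂ => g (p + z • t)) 0 := by
        have h1 : ContinuousAt g (p + (0 : ℂ) • t) := by
          rw [zero_smul, add_zero]
          exact (hd'.continuousOn).continuousAt (isOpen_ball.mem_nhds hp)
        exact ContinuousAt.comp (f := fun z : ℂ => p + z • t) h1 (by fun_prop)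
      simpa using hc.tendsto.isBigO_one ℂ
    | succ k ih =>
      intro hk
      have h2 := D.vanishesTo_succ
        (I := Finset.univ.filter fun i => D.center J ≤ LinearMap.ker (D.g i)) (k := k) hβ0
        isOpen_ball hd' hM' (by rw [D.center_filter_center_le]; exact ih (by omega)) hfin
        (by rw [D.center_filter_center_le]; exact hβ J k (Finset.mem_range.2 hk) hJ)
      rwa [D.center_filter_center_le] at h2
  obtain ⟨ρ, hρ, C, hC, hle⟩ := D.exists_setLIntegral_le h0 K
    (fun J _ => lt_of_le_of_lt (by gcongr; exact D.weight_le_mu_center J) (hKspec J))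
    (Finset.univ.filter fun i => D.g i x = 0) x
    (Arrangement.mem_center.2 fun i hi => (Finset.mem_filter.1 hi).2) r hr
  have hle' := hle g M hd' hM' fun J _ hJ => hvan J hJ _ le_rfl
  obtain ⟨B, hB, hBx⟩ := D.exists_norm_part_rpow_le Finset.univ x α
  obtain ⟨ε, hε, hεB⟩ := Metric.eventually_nhds_iff_ball.1 hBx
  refine hnot (ball x (min r (min ρ ε)))
    (ball_mem_nhds x (lt_min hr (lt_min hρ hε))) ⟨?_, ?_⟩
  · refine AEStronglyMeasurable.mul ?_ ?_
    · refine ContinuousOn.aestronglyMeasurable ?_ measurableSet_ball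
      exact (hd'.continuousOn.mono (ball_subset_ball (min_le_left _ _))).norm.pow 2
    · exact ((D.continuous_part Finset.univ).norm.measurable.pow_const _).aestronglyMeasurable
  · rw [hasFiniteIntegral_iff_ofReal (Filter.Eventually.of_forall fun y => by positivity)]
    calc ∫⁻ y in ball x (min r (min ρ ε)), ENNReal.ofReal (‖g y‖ ^ 2 * ‖D.f y‖ ^ (-2 * α))
        ≤ ∫⁻ y in ball x (min r (min ρ ε)), ENNReal.ofReal B * ENNReal.ofReal (‖g y‖ ^ 2 *
            ‖D.part (Finset.univ.filter fun i => D.g i x = 0) y‖ ^ (-2 * α)) := by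
          refine setLIntegral_mono' measurableSet_ball fun y hy => ?_
          rw [← ENNReal.ofReal_mul hB.le]
          refine ENNReal.ofReal_le_ofReal ?_
          rw [mul_left_comm]
          gcongr
          exact hεB y (ball_subset_ball ((min_le_right _ _).trans (min_le_right _ _)) hy)
      _ = ENNReal.ofReal B * ∫⁻ y in ball x (min r (min ρ ε)), ENNReal.ofReal (‖g y‖ ^ 2 *
            ‖D.part (Finset.univ.filter fun i => D.g i x = 0) y‖ ^ (-2 * α)) :=
          lintegral_const_mul' _ _ ENNReal.ofReal_ne_top
      _ ≤ ENNReal.ofReal B * (C * ENNReal.ofReal (M ^ 2)) := by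
          gcongr
          exact (lintegral_mono_set (ball_subset_ball
            ((min_le_right _ _).trans (min_le_left _ _)))).trans hle'
      _ < ⊤ := ENNReal.mul_lt_top ENNReal.ofReal_lt_top
          (ENNReal.mul_lt_top hC.lt_top ENNReal.ofReal_lt_top)
end
end
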